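/- arXiv:2102.00049 — 2 statements merged into one kernel-verified Lean document; each statement's English description precedes it below -/
import Mathlib

section
/- Let h : S¹ → S¹ be an orientation-preserving homeomorphism and suppose there exist a non-negative function g ∈ L¹([0,2π]) and constants M > 0, t₀ ∈ (0, π/2) such that ρ_h^c(θ,t) ≤ M · log((1 + g(θ))/t) for all θ ∈ [0,2π] and all 0 < t < t₀. Then there exists an orientation-preserving homeomorphism H of the closed unit disk onto itself with H restricted to S¹ equal to h, such that H is continuously differentiable on the open unit disk 𝔻 with positive Jacobian determinant, and there exists p > 0 with ∫_𝔻 e^{p K_H(x,y)} dx dy < ∞. -/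
open MeasureTheory Set Function Real

noncomputable section

/-- The length of the arc of the unit circle from `a` to `b` in the positive orientation:
the unique `s ∈ [0, 2π)` with `b = a·e^{is}`. -/
def arcLen (a b : Circle) : ℝ :=
  if 0 ≤ Complex.arg ((b : ℂ) / (a : ℂ)) then Complex.arg ((b : ℂ) / (a : ℂ))
  else Complex.arg ((b : ℂ) / (a : ℂ)) + 2 * π

/-- The circular symmetric distortion function of a circle homeomorphism `h`. -/
def rhoCirc (h : Circle → Circle) (θ t : ℝ) : ℝ :=
  max (arcLen (h (Circle.exp θ)) (h (Circle.exp (θ + t))) /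
        arcLen (h (Circle.exp (θ - t))) (h (Circle.exp θ)))
      (arcLen (h (Circle.exp (θ - t))) (h (Circle.exp θ)) /
        arcLen (h (Circle.exp θ)) (h (Circle.exp (θ + t))))

/-- `h : S¹ → S¹` is an orientation-preserving homeomorphism: it lifts to an increasing
homeomorphism of `ℝ` commuting with the translation `x ↦ x + 2π`. -/
def IsOrientationPresHomeo (h : Circle → Circle) : Prop :=
  ∃ g : ℝ → ℝ, StrictMono g ∧ Continuous g ∧ Surjective g ∧
    (∀ θ : ℝ, g (θ + 2 * π) = g θ + 2 * π) ∧
    ∀ θ : ℝ, h (Circle.exp θ) = Circle.exp (g θ)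

/-- The quasiconformal dilatation `‖DH‖²/J_H` of a map `H : ℂ → ℂ` at the point `z`. -/
def dilC (H : ℂ → ℂ) (z : ℂ) : ℝ :=
  ‖fderiv ℝ H z‖ ^ 2 / (fderiv ℝ H z).det

section Extension

open Filter Topology
open scoped ENNReal

section LinearMaps

/-- A real-linear map of `ℂ` is determined by its values at `1` and `I`. -/
lemma Complex.clm_apply_eq (T : ℂ →L[ℝ] ℂ) (z : ℂ) :
    T z = z.re • T 1 + z.im • T Complex.I := by
  rw [← map_smul, ← map_smul, ← map_add]
  congr 1
  apply Complex.ext <;> simp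

lemma Complex.clm_det_eq (T : ℂ →L[ℝ] ℂ) :
    T.det = (T 1).re * (T Complex.I).im - (T Complex.I).re * (T 1).im := by
  rw [ContinuousLinearMap.det, ← LinearMap.det_toMatrix Complex.basisOneI, Matrix.det_fin_two]
  simp [LinearMap.toMatrix_apply]

lemma Complex.clm_norm_le (T : ℂ →L[ℝ] ℂ) : ‖T‖ ≤ ‖T 1‖ + ‖T Complex.I‖ := by
  refine ContinuousLinearMap.opNorm_le_bound _ (by positivity) fun z => ?_
  rw [Complex.clm_apply_eq T z]
  refine (norm_add_le _ _).trans ?_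
  rw [norm_smul, norm_smul, add_mul, mul_comm ‖T 1‖, mul_comm ‖T Complex.I‖]
  gcongr
  · exact Complex.abs_re_le_norm z
  · exact Complex.abs_im_le_norm z

end LinearMaps

/-- The mean of `f` over the segment from `x` to `x + y`. -/
def segMean (f : ℝ → ℝ) (x y : ℝ) : ℝ := ∫ t in (0 : ℝ)..1, f (x + t * y)

section SegMean

variable {f : ℝ → ℝ}

lemma continuous_segMean (hf : Continuous f) : Continuous fun p : ℝ × ℝ => segMean f p.1 p.2 := by
  unfold segMean
  apply intervalIntegral.continuous_parametric_intervalIntegral_of_continuous'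
  fun_prop

@[simp] lemma segMean_zero (x : ℝ) : segMean f x 0 = f x := by
  simp [segMean]

lemma segMean_lt_segMean (hf : Continuous f) (hm : StrictMono f) {x y x' y' : ℝ}
    (hx : x ≤ x') (hxy : x + y ≤ x' + y') (hne : x < x' ∨ x + y < x' + y') :
    segMean f x y < segMean f x' y' := by
  refine intervalIntegral.integral_lt_integral_of_continuousOn_of_le_of_exists_lt one_pos
    (by fun_prop) (by fun_prop) (fun t ht => hm.monotone ?_) ?_
  · nlinarith [mul_nonneg (sub_nonneg.2 ht.2) (sub_nonneg.2 hx),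
      mul_nonneg ht.1.le (sub_nonneg.2 hxy)]
  · rcases hne with h | h
    · exact ⟨0, by simp, hm (by simpa using h)⟩
    · exact ⟨1, by simp, hm (by simpa using h)⟩

lemma segMean_eq_div {y : ℝ} (hy : y ≠ 0) (x : ℝ) :
    segMean f x y = (∫ s in x..(x + y), f s) / y := by
  have := intervalIntegral.integral_comp_add_mul (a := 0) (b := 1) f hy x
  simp only [segMean, mul_comm _ y, this]
  simp [div_eq_inv_mul]

lemma segMean_eq_primitive (hf : Continuous f) {y : ℝ} (hy : y ≠ 0) (x : ℝ) :
    segMean f x y = ((∫ s in (0 : ℝ)..(x + y), f s) - ∫ s in (0 : ℝ)..x, f s) / y := by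
  rw [segMean_eq_div hy, intervalIntegral.integral_interval_sub_left] <;>
    exact hf.intervalIntegrable _ _

lemma hasDerivAt_primitive (hf : Continuous f) (x : ℝ) :
    HasDerivAt (fun u => ∫ s in (0 : ℝ)..u, f s) (f x) x :=
  (intervalIntegral.integral_hasStrictDerivAt_right (hf.intervalIntegrable _ _)
    (hf.stronglyMeasurableAtFilter _ _) hf.continuousAt).hasDerivAt

lemma contDiff_primitive (hf : Continuous f) :
    ContDiff ℝ 1 (fun u => ∫ s in (0 : ℝ)..u, f s) := by
  rw [contDiff_one_iff_deriv]
  refine ⟨fun x => (hasDerivAt_primitive hf x).differentiableAt, ?_⟩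
  rwa [show deriv (fun u => ∫ s in (0 : ℝ)..u, f s) = f from
    funext fun x => (hasDerivAt_primitive hf x).deriv]

variable {E : Type*} [NormedAddCommGroup E] [NormedSpace ℝ E]

lemma contDiffAt_segMean (hf : Continuous f) {X Y : E → ℝ} {z : E}
    (hX : ContDiff ℝ 1 X) (hY : ContDiff ℝ 1 Y) (hz : Y z ≠ 0) :
    ContDiffAt ℝ 1 (fun w => segMean f (X w) (Y w)) z := by
  have h : (fun w => ((∫ s in (0 : ℝ)..(X w + Y w), f s) - ∫ s in (0 : ℝ)..(X w), f s) / Y w)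
      =ᶠ[𝓝 z] fun w => segMean f (X w) (Y w) := by
    filter_upwards [hY.continuous.continuousAt.eventually_ne hz] with w hw
    rw [segMean_eq_primitive hf hw]
  refine ContDiffAt.congr_of_eventuallyEq ?_ h.symm
  have hP := contDiff_primitive hf
  refine ContDiffAt.div ?_ hY.contDiffAt hz
  exact ((hP.comp (hX.add hY)).sub (hP.comp hX)).contDiffAt

lemma hasFDerivAt_segMean (hf : Continuous f) {X Y : E → ℝ} {X' Y' : E →L[ℝ] ℝ} {z : E}
    (hX : HasFDerivAt X X' z) (hY : HasFDerivAt Y Y' z) (hz : Y z ≠ 0) :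
    HasFDerivAt (fun w => segMean f (X w) (Y w))
      ((Y z)⁻¹ • ((f (X z + Y z) - f (X z)) • X' +
        (f (X z + Y z) - segMean f (X z) (Y z)) • Y')) z := by
  have h : (fun w => ((∫ s in (0 : ℝ)..(X w + Y w), f s) - ∫ s in (0 : ℝ)..(X w), f s) / Y w)
      =ᶠ[𝓝 z] fun w => segMean f (X w) (Y w) := by
    filter_upwards [hY.continuousAt.eventually_ne hz] with w hw
    rw [segMean_eq_primitive hf hw]
  refine HasFDerivAt.congr_of_eventuallyEq ?_ h.symm
  have h1 := (hasDerivAt_primitive hf (X z + Y z)).comp_hasFDerivAt z (hX.add hY)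
  have h2 := (hasDerivAt_primitive hf (X z)).comp_hasFDerivAt z hX
  have h3 := (h1.sub h2).mul ((hasDerivAt_inv hz).comp_hasFDerivAt z hY)
  simp only [div_eq_mul_inv]
  refine h3.congr_fderiv ?_
  ext v
  rw [segMean_eq_primitive hf hz]
  simp
  field_simp
  ring

end SegMean

/-- The Beurling-Ahlfors extension of `f`, in the coordinate `ζ = -y + i x` of the left
half-plane (so that it is conjugate by `exp` to a self-map of the punctured disk). -/
def logExt (f : ℝ → ℝ) (ζ : ℂ) : ℂ :=
  ⟨-(segMean f ζ.im (-ζ.re) - segMean f ζ.im ζ.re),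
    (segMean f ζ.im (-ζ.re) + segMean f ζ.im ζ.re) / 2⟩

section LogExt

variable {f : ℝ → ℝ}

lemma logExt_eq (f : ℝ → ℝ) (ζ : ℂ) : logExt f ζ =
    ((-(segMean f ζ.im (-ζ.re) - segMean f ζ.im ζ.re) : ℝ) : ℂ) +
    (((segMean f ζ.im (-ζ.re) + segMean f ζ.im ζ.re) / 2 : ℝ) : ℂ) * Complex.I := by
  apply Complex.ext <;> simp [logExt]

lemma continuous_logExt (hf : Continuous f) : Continuous (logExt f) := by
  have h1 : Continuous fun ζ : ℂ => segMean f ζ.im (-ζ.re) :=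
    (continuous_segMean hf).comp (by fun_prop : Continuous fun ζ : ℂ => (ζ.im, -ζ.re))
  have h2 : Continuous fun ζ : ℂ => segMean f ζ.im ζ.re :=
    (continuous_segMean hf).comp (by fun_prop : Continuous fun ζ : ℂ => (ζ.im, ζ.re))
  rw [funext (logExt_eq f)]
  fun_prop

lemma logExt_add_period (hper : ∀ x, f (x + 2 * π) = f x + 2 * π) (hf : Continuous f) (n : ℤ)
    (ζ : ℂ) : logExt f (ζ + n * (2 * π * Complex.I)) = logExt f ζ + n * (2 * π * Complex.I) := by
  have hn : ∀ x, f (x + n * (2 * π)) = f x + n * (2 * π) := by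
    have hp : Function.Periodic (fun x => f x - x) (2 * π) := fun x => by
      simp only [hper]; ring
    intro x
    have : f (x + n * (2 * π)) - (x + n * (2 * π)) = f x - x := hp.int_mul n x
    linarith
  have hS : ∀ x y, segMean f (x + n * (2 * π)) y = segMean f x y + n * (2 * π) := by
    intro x y
    have : ∀ t : ℝ, f (x + n * (2 * π) + t * y) = f (x + t * y) + n * (2 * π) := fun t => by
      rw [← hn]; ring_nf
    simp only [segMean, this]
    rw [intervalIntegral.integral_add ((by fun_prop :
      Continuous fun t : ℝ => f (x + t * y)).intervalIntegrable _ _) (by simp)]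
    simp
  apply Complex.ext
  · simp [logExt, hS]
  · simp [logExt, hS]
    ring

lemma re_logExt_neg (hf : Continuous f) (hm : StrictMono f) {ζ : ℂ} (hζ : ζ.re < 0) :
    (logExt f ζ).re < 0 := by
  have : segMean f ζ.im ζ.re < segMean f ζ.im (-ζ.re) :=
    segMean_lt_segMean hf hm le_rfl (by linarith) (Or.inr (by linarith))
  simp only [logExt]
  linarith

lemma logExt_of_re_eq_zero {ζ : ℂ} (hζ : ζ.re = 0) :
    logExt f ζ = f ζ.im * Complex.I := by
  apply Complex.ext <;> simp [logExt, hζ]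

lemma logExt_injOn (hf : Continuous f) (hm : StrictMono f) :
    InjOn (logExt f) {ζ | ζ.re ≤ 0} := by
  have key : ∀ x y x' y' : ℝ, 0 ≤ y → 0 ≤ y' → segMean f x y = segMean f x' y' →
      segMean f x (-y) = segMean f x' (-y') → ¬ x < x' := by
    intro x y x' y' hy hy' h1 h2 hlt
    have h3 : x' + y' < x + y := by
      by_contra! h
      exact (segMean_lt_segMean hf hm hlt.le h (Or.inl hlt)).ne h1
    have h4 : x' + -y' < x + -y := by
      by_contra! h
      exact (segMean_lt_segMean hf hm hlt.le h (Or.inl hlt)).ne h2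
    linarith
  have key2 : ∀ x y y' : ℝ, segMean f x y = segMean f x y' → ¬ y < y' := fun x y y' h1 hlt =>
    (segMean_lt_segMean hf hm le_rfl (by linarith) (Or.inr (by linarith))).ne h1
  intro ζ hζ ξ hξ h
  have hre := congrArg Complex.re h
  have him := congrArg Complex.im h
  simp only [logExt] at hre him
  have h1 : segMean f ζ.im (-ζ.re) = segMean f ξ.im (-ξ.re) := by linarith
  have h2 : segMean f ζ.im ζ.re = segMean f ξ.im ξ.re := by linarith
  have hζ' : ζ.re ≤ 0 := hζ
  have hξ' : ξ.re ≤ 0 := hξ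
  have hx : ζ.im = ξ.im := le_antisymm
    (not_lt.1 (key _ (-ξ.re) _ (-ζ.re) (by linarith) (by linarith) h1.symm (by simpa using h2.symm)))
    (not_lt.1 (key _ (-ζ.re) _ (-ξ.re) (by linarith) (by linarith) h1 (by simpa using h2)))
  rw [hx] at h2
  exact Complex.ext (le_antisymm (not_lt.1 (key2 _ _ _ h2.symm)) (not_lt.1 (key2 _ _ _ h2))) hx

lemma contDiffAt_logExt (hf : Continuous f) {ζ : ℂ} (hζ : ζ.re ≠ 0) :
    ContDiffAt ℝ 1 (logExt f) ζ := by
  have h1 : ContDiffAt ℝ 1 (fun ζ : ℂ => segMean f ζ.im (-ζ.re)) ζ :=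
    contDiffAt_segMean hf Complex.imCLM.contDiff Complex.reCLM.contDiff.neg (by simpa using hζ)
  have h2 : ContDiffAt ℝ 1 (fun ζ : ℂ => segMean f ζ.im ζ.re) ζ :=
    contDiffAt_segMean hf Complex.imCLM.contDiff Complex.reCLM.contDiff (by simpa using hζ)
  rw [funext (logExt_eq f)]
  refine ContDiffAt.add ?_ (ContDiffAt.mul ?_ contDiffAt_const)
  · exact Complex.ofRealCLM.contDiff.contDiffAt.comp ζ (h1.sub h2).neg
  · exact Complex.ofRealCLM.contDiff.contDiffAt.comp ζ ((h1.add h2).div_const 2)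

lemma fderiv_logExt (hf : Continuous f) {x y : ℝ} (hy : y ≠ 0) :
    fderiv ℝ (logExt f) ⟨-y, x⟩ 1 =
      ⟨((f (x + y) - segMean f x y) + (segMean f x (-y) - f (x - y))) / y,
        ((segMean f x (-y) - f (x - y)) - (f (x + y) - segMean f x y)) / (2 * y)⟩ ∧
    fderiv ℝ (logExt f) ⟨-y, x⟩ Complex.I =
      ⟨((f x - f (x - y)) - (f (x + y) - f x)) / y, (f (x + y) - f (x - y)) / (2 * y)⟩ := by
  set ζ : ℂ := ⟨-y, x⟩ with hζ
  have h1 := hasFDerivAt_segMean (z := ζ) hf Complex.imCLM.hasFDerivAt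
    (Complex.reCLM.hasFDerivAt.neg) (by simpa [hζ] using hy)
  have h2 := hasFDerivAt_segMean (z := ζ) hf Complex.imCLM.hasFDerivAt
    (Complex.reCLM.hasFDerivAt) (by simpa [hζ] using hy)
  have h3 := (Complex.ofRealCLM.hasFDerivAt.comp ζ (h1.sub h2).neg).add
    ((Complex.ofRealCLM.hasFDerivAt.comp ζ ((h1.add h2).mul_const (1 / 2))).mul_const Complex.I)
  have h4 := h3.congr_of_eventuallyEq (f₁ := logExt f) (Eventually.of_forall fun w => by
    rw [logExt_eq]
    simp [div_eq_mul_inv])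
  rw [h4.fderiv]
  constructor
  · apply Complex.ext
    · simp [hζ]
      field_simp
      ring_nf
    · simp [hζ]
      field_simp
      ring_nf
  · apply Complex.ext
    · simp [hζ]
      field_simp
      ring_nf
    · simp [hζ]
      field_simp
      ring_nf

end LogExt

section Asymptotics

variable {f : ℝ → ℝ}

lemma periodic_sub_self (hper : ∀ x, f (x + 2 * π) = f x + 2 * π) :
    Function.Periodic (fun x => f x - x) (2 * π) := fun x => by
  simp only [hper]; ring

lemma exists_abs_sub_self_le (hf : Continuous f) (hper : ∀ x, f (x + 2 * π) = f x + 2 * π) :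
    ∃ B, 0 ≤ B ∧ ∀ x, |f x - x| ≤ B := by
  obtain ⟨B, hB⟩ := ((periodic_sub_self hper).isBounded_of_continuous two_pi_pos.ne'
    (by fun_prop)).exists_norm_le
  have h : ∀ x, |f x - x| ≤ B := fun x => hB _ ⟨x, rfl⟩
  exact ⟨B, (abs_nonneg _).trans (h 0), h⟩

lemma segMean_sub_eq (hf : Continuous f) (x y : ℝ) :
    segMean (fun s => f s - s) x y = segMean f x y - (x + y / 2) := by
  unfold segMean
  rw [intervalIntegral.integral_sub
    ((by fun_prop : Continuous fun t : ℝ => f (x + t * y)).intervalIntegrable _ _)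
    ((by fun_prop : Continuous fun t : ℝ => x + t * y).intervalIntegrable _ _),
    intervalIntegral.integral_add (by simp)
    ((by fun_prop : Continuous fun t : ℝ => t * y).intervalIntegrable _ _),
    intervalIntegral.integral_mul_const]
  simp
  ring

lemma abs_segMean_le {p : ℝ → ℝ} {B : ℝ} (hB : ∀ x, |p x| ≤ B) (x y : ℝ) :
    |segMean p x y| ≤ B := by
  have := intervalIntegral.norm_integral_le_of_norm_le_const (a := 0) (b := 1)
    (f := fun t => p (x + t * y)) (C := B) (fun t _ => hB _)
  simpa [segMean] using this

lemma exists_norm_fderiv_logExt_sub_le (hf : Continuous f)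
    (hper : ∀ x, f (x + 2 * π) = f x + 2 * π) :
    ∃ C, ∀ ζ : ℂ, ζ.re < 0 →
      ‖fderiv ℝ (logExt f) ζ - ContinuousLinearMap.id ℝ ℂ‖ ≤ C / -ζ.re := by
  obtain ⟨B, hB0, hB⟩ := exists_abs_sub_self_le hf hper
  refine ⟨11 * B, fun ζ hζ => ?_⟩
  obtain ⟨y, hy⟩ : ∃ y, y = -ζ.re := ⟨_, rfl⟩
  obtain ⟨x, hx⟩ : ∃ x, x = ζ.im := ⟨_, rfl⟩
  have hy0 : 0 < y := by linarith
  have hζe : ζ = ⟨-y, x⟩ := Complex.ext (by simp [hy]) hx.symm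
  obtain ⟨h1, hI⟩ := fderiv_logExt hf (x := x) hy0.ne'
  rw [← hy, hζe]
  refine (Complex.clm_norm_le _).trans ?_
  have hα := abs_segMean_le hB x y
  have hβ := abs_segMean_le hB x (-y)
  rw [segMean_sub_eq hf] at hα hβ
  have e1 := hB (x + y)
  have e2 := hB (x - y)
  have e3 := hB x
  rw [abs_le] at hα hβ e1 e2 e3
  have n1 : ‖(fderiv ℝ (logExt f) ⟨-y, x⟩ - ContinuousLinearMap.id ℝ ℂ) 1‖ ≤ 6 * B / y := by
    rw [sub_apply, h1]
    refine (Complex.norm_le_abs_re_add_abs_im _).trans ?_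
    have r1 : |((f (x + y) - segMean f x y) + (segMean f x (-y) - f (x - y))) / y - 1|
        ≤ 4 * B / y := by
      rw [div_sub_one hy0.ne', abs_div, abs_of_pos hy0]
      gcongr
      rw [abs_le]; constructor <;> linarith
    have r2 : |((segMean f x (-y) - f (x - y)) - (f (x + y) - segMean f x y)) / (2 * y)|
        ≤ 4 * B / (2 * y) := by
      rw [abs_div, abs_of_pos (by positivity : 0 < 2 * y)]
      gcongr
      rw [abs_le]; constructor <;> linarith
    have r3 : 4 * B / (2 * y) = 2 * B / y := by field_simp; ring
    have r4 : 6 * B / y = 4 * B / y + 2 * B / y := by ring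
    simp only [Complex.sub_re, Complex.sub_im, ContinuousLinearMap.id_apply, Complex.one_re,
      Complex.one_im, sub_zero]
    linarith
  have n2 : ‖(fderiv ℝ (logExt f) ⟨-y, x⟩ - ContinuousLinearMap.id ℝ ℂ) Complex.I‖
      ≤ 5 * B / y := by
    rw [sub_apply, hI]
    refine (Complex.norm_le_abs_re_add_abs_im _).trans ?_
    have r1 : |((f x - f (x - y)) - (f (x + y) - f x)) / y| ≤ 4 * B / y := by
      rw [abs_div, abs_of_pos hy0]
      gcongr
      rw [abs_le]; constructor <;> linarith
    have r2 : |(f (x + y) - f (x - y)) / (2 * y) - 1| ≤ 2 * B / (2 * y) := by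
      rw [div_sub_one (by positivity), abs_div, abs_of_pos (by positivity : 0 < 2 * y)]
      gcongr
      rw [abs_le]; constructor <;> linarith
    have r3 : 2 * B / (2 * y) = B / y := by field_simp
    have r4 : 5 * B / y = 4 * B / y + B / y := by ring
    simp only [Complex.sub_re, Complex.sub_im, ContinuousLinearMap.id_apply, Complex.I_re,
      Complex.I_im, sub_zero]
    linarith
  have r4 : 11 * B / y = 6 * B / y + 5 * B / y := by ring
  linarith

lemma exists_segMean_asymptotic (hf : Continuous f)
    (hper : ∀ x, f (x + 2 * π) = f x + 2 * π) :
    ∃ c C, ∀ x y, y ≠ 0 → |segMean f x y - (x + y / 2) - c| ≤ C / |y| := by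
  set p : ℝ → ℝ := fun x => f x - x with hp
  have hpc : Continuous p := by fun_prop
  have hpp : Function.Periodic p (2 * π) := periodic_sub_self hper
  set c : ℝ := (∫ s in (0 : ℝ)..(0 + 2 * π), p s) / (2 * π) with hc
  set R : ℝ → ℝ := fun u => ∫ s in (0 : ℝ)..u, (p s - c) with hR
  have hint : ∀ a b, IntervalIntegrable (fun s => p s - c) volume a b := fun a b =>
    (by fun_prop : Continuous fun s => p s - c).intervalIntegrable _ _
  have hRp : Function.Periodic R (2 * π) := by
    intro x
    have h1 : R (x + 2 * π) - R x = ∫ s in x..(x + 2 * π), (p s - c) :=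
      intervalIntegral.integral_interval_sub_left (hint _ _) (hint _ _)
    rw [intervalIntegral.integral_sub (hpc.intervalIntegrable _ _) (by simp),
      hpp.intervalIntegral_add_eq x 0] at h1
    have h2 : (∫ s in (0 : ℝ)..(0 + 2 * π), p s) = c * (2 * π) := by
      rw [hc]; field_simp
    rw [h2] at h1
    simp at h1
    linarith
  have hRc : Continuous R := intervalIntegral.continuous_primitive hint 0
  obtain ⟨C, hC⟩ := (hRp.isBounded_of_continuous two_pi_pos.ne' hRc).exists_norm_le
  refine ⟨c, 2 * C, fun x y hy => ?_⟩
  have h1 : segMean f x y - (x + y / 2) - c = (R (x + y) - R x) / y := by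
    rw [← segMean_sub_eq hf, segMean_eq_div hy]
    have h1 : R (x + y) - R x = ∫ s in x..(x + y), (p s - c) :=
      intervalIntegral.integral_interval_sub_left (hint _ _) (hint _ _)
    rw [h1, intervalIntegral.integral_sub (hpc.intervalIntegrable _ _) (by simp)]
    simp
    field_simp
    rfl
  rw [h1, abs_div]
  gcongr
  have h2 := hC (R (x + y)) ⟨_, rfl⟩
  have h3 := hC (R x) ⟨_, rfl⟩
  rw [Real.norm_eq_abs] at h2 h3
  exact (abs_sub _ _).trans (by linarith)

lemma exists_logExt_asymptotic (hf : Continuous f)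
    (hper : ∀ x, f (x + 2 * π) = f x + 2 * π) :
    ∃ c C : ℝ, ∀ ζ : ℂ, ζ.re < 0 → ‖logExt f ζ - ζ - c * Complex.I‖ ≤ C / -ζ.re := by
  obtain ⟨c, C, h⟩ := exists_segMean_asymptotic hf hper
  refine ⟨c, 3 * C, fun ζ hζ => ?_⟩
  have h1 := h ζ.im (-ζ.re) (by linarith)
  have h2 := h ζ.im ζ.re hζ.ne
  rw [abs_of_pos (neg_pos.2 hζ)] at h1
  rw [abs_of_neg hζ] at h2
  refine (Complex.norm_le_abs_re_add_abs_im _).trans ?_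
  have hr : 3 * C / -ζ.re = C / -ζ.re + C / -ζ.re + C / -ζ.re := by ring
  rw [hr]
  rw [abs_le] at h1 h2
  have h3 : |(logExt f ζ - ζ - c * Complex.I).re| ≤ C / -ζ.re + C / -ζ.re := by
    simp only [logExt, Complex.sub_re, Complex.mul_re, Complex.I_re, Complex.I_im,
      Complex.ofReal_im]
    rw [abs_le]; constructor <;> linarith
  have h4 : |(logExt f ζ - ζ - c * Complex.I).im| ≤ C / -ζ.re := by
    simp only [logExt, Complex.sub_im, Complex.mul_im, Complex.I_re, Complex.I_im,
      Complex.ofReal_im, Complex.ofReal_re]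
    rw [abs_le]; constructor <;> linarith
  linarith

lemma tendsto_div_neg_log_re (C : ℝ) :
    Tendsto (fun w : ℂ => C / -(Complex.log w).re) (𝓝[≠] 0) (𝓝 0) := by
  have h1 : Tendsto (fun w : ℂ => ‖w‖) (𝓝[≠] 0) (𝓝[>] 0) := tendsto_norm_nhdsNE_zero
  have h2 := tendsto_neg_atBot_atTop.comp (Real.tendsto_log_nhdsGT_zero.comp h1)
  have h3 := h2.const_div_atTop C
  simpa only [Function.comp_def, Complex.log_re] using h3

end Asymptotics

/-- The extension of the circle homeomorphism with lift `f` obtained by conjugating the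
Beurling-Ahlfors extension of `f` by the exponential. -/
def diskExt (f : ℝ → ℝ) (w : ℂ) : ℂ :=
  if w = 0 then 0 else Complex.exp (logExt f (Complex.log w))

section DiskExt

variable {f : ℝ → ℝ}

@[simp] lemma diskExt_zero : diskExt f 0 = 0 := by simp [diskExt]

lemma diskExt_exp (hf : Continuous f) (hper : ∀ x, f (x + 2 * π) = f x + 2 * π) (ζ : ℂ) :
    diskExt f (Complex.exp ζ) = Complex.exp (logExt f ζ) := by
  have h0 := Complex.exp_ne_zero ζ
  obtain ⟨n, hn⟩ := Complex.exp_eq_exp_iff_exists_int.1 (Complex.exp_log h0)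
  rw [diskExt, if_neg h0, hn, logExt_add_period hper hf]
  exact Complex.exp_eq_exp_iff_exists_int.2 ⟨n, rfl⟩

lemma diskExt_of_ne_zero {w : ℂ} (hw : w ≠ 0) :
    diskExt f w = Complex.exp (logExt f (Complex.log w)) := if_neg hw

lemma diskExt_eventuallyEq (hf : Continuous f) (hper : ∀ x, f (x + 2 * π) = f x + 2 * π)
    (ζ : ℂ) : diskExt f =ᶠ[𝓝 (Complex.exp ζ)]
      fun w => Complex.exp (logExt f (Complex.log (w / Complex.exp ζ) + ζ)) := by
  have h0 := Complex.exp_ne_zero ζ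
  filter_upwards [eventually_ne_nhds h0] with w hw
  rw [← diskExt_exp hf hper, Complex.exp_add, Complex.exp_log (div_ne_zero hw h0),
    div_mul_cancel₀ _ h0]

lemma contDiffAt_logBranch (ζ : ℂ) :
    ContDiffAt ℝ 1 (fun w => Complex.log (w / Complex.exp ζ) + ζ) (Complex.exp ζ) := by
  have h : ContDiffAt ℂ 1 (fun w => Complex.log (w / Complex.exp ζ) + ζ) (Complex.exp ζ) := by
    refine ContDiffAt.add (ContDiffAt.comp _ (Complex.contDiffAt_log ?_)
      (contDiffAt_id.div_const _)) contDiffAt_const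
    simp [Complex.exp_ne_zero]
  exact h.restrict_scalars ℝ

lemma contDiffAt_diskExt_exp (hf : Continuous f) (hper : ∀ x, f (x + 2 * π) = f x + 2 * π)
    {ζ : ℂ} (hζ : ζ.re ≠ 0) : ContDiffAt ℝ 1 (diskExt f) (Complex.exp ζ) := by
  refine ContDiffAt.congr_of_eventuallyEq ?_ (diskExt_eventuallyEq hf hper ζ)
  refine (Complex.contDiff_exp (𝕜 := ℝ)).contDiffAt.comp _ ?_
  refine ContDiffAt.comp _ (g := logExt f) (contDiffAt_logExt hf ?_) (contDiffAt_logBranch ζ)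
  simpa [Complex.exp_ne_zero] using hζ

lemma continuousAt_diskExt_exp (hf : Continuous f) (hper : ∀ x, f (x + 2 * π) = f x + 2 * π)
    (ζ : ℂ) : ContinuousAt (diskExt f) (Complex.exp ζ) := by
  refine ContinuousAt.congr ?_ (diskExt_eventuallyEq hf hper ζ).symm
  exact Complex.continuous_exp.continuousAt.comp
    ((continuous_logExt hf).continuousAt.comp (contDiffAt_logBranch ζ).continuousAt)

lemma fderiv_diskExt_exp (hf : Continuous f) (hper : ∀ x, f (x + 2 * π) = f x + 2 * π)
    {ζ : ℂ} (hζ : ζ.re ≠ 0) (v : ℂ) :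
    fderiv ℝ (diskExt f) (Complex.exp ζ) (Complex.exp ζ * v) =
      Complex.exp (logExt f ζ) * fderiv ℝ (logExt f) ζ v := by
  have h1 : HasFDerivAt (diskExt f) (fderiv ℝ (diskExt f) (Complex.exp ζ)) (Complex.exp ζ) :=
    ((contDiffAt_diskExt_exp hf hper hζ).differentiableAt one_ne_zero).hasFDerivAt
  have h2 : HasFDerivAt (logExt f) (fderiv ℝ (logExt f) ζ) ζ :=
    ((contDiffAt_logExt hf hζ).differentiableAt one_ne_zero).hasFDerivAt
  have e1 := (Complex.hasDerivAt_exp ζ).hasFDerivAt.restrictScalars ℝ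
  have e2 := (Complex.hasDerivAt_exp (logExt f ζ)).hasFDerivAt.restrictScalars ℝ
  have h3 := h1.comp ζ e1
  have h4 := e2.comp ζ h2
  have h5 : diskExt f ∘ Complex.exp = Complex.exp ∘ logExt f :=
    funext fun ξ => diskExt_exp hf hper ξ
  rw [h5] at h3
  have h6 := congrArg (fun T : ℂ →L[ℝ] ℂ => T v) (h3.unique h4)
  simpa [mul_comm] using h6

lemma fderiv_diskExt_exp_apply (hf : Continuous f) (hper : ∀ x, f (x + 2 * π) = f x + 2 * π)
    {ζ : ℂ} (hζ : ζ.re ≠ 0) (v : ℂ) :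
    fderiv ℝ (diskExt f) (Complex.exp ζ) v =
      Complex.exp (logExt f ζ) * fderiv ℝ (logExt f) ζ (v / Complex.exp ζ) := by
  rw [← fderiv_diskExt_exp hf hper hζ, mul_div_cancel₀ _ (Complex.exp_ne_zero ζ)]

lemma Complex.det_mulLeft (c : ℂ) : (ContinuousLinearMap.mul ℝ ℂ c).det = ‖c‖ ^ 2 := by
  rw [Complex.clm_det_eq, Complex.sq_norm, Complex.normSq_apply]
  simp

lemma det_fderiv_diskExt_exp (hf : Continuous f) (hper : ∀ x, f (x + 2 * π) = f x + 2 * π)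
    {ζ : ℂ} (hζ : ζ.re ≠ 0) :
    (fderiv ℝ (diskExt f) (Complex.exp ζ)).det * ‖Complex.exp ζ‖ ^ 2 =
      ‖Complex.exp (logExt f ζ)‖ ^ 2 * (fderiv ℝ (logExt f) ζ).det := by
  rw [← Complex.det_mulLeft, ← Complex.det_mulLeft]
  simp only [ContinuousLinearMap.det]
  rw [← LinearMap.det_comp, ← LinearMap.det_comp]
  congr 1
  ext v
  exact fderiv_diskExt_exp hf hper hζ v

lemma norm_fderiv_diskExt_exp_le (hf : Continuous f)
    (hper : ∀ x, f (x + 2 * π) = f x + 2 * π) {ζ : ℂ} (hζ : ζ.re ≠ 0) :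
    ‖fderiv ℝ (diskExt f) (Complex.exp ζ)‖ ≤
      ‖Complex.exp (logExt f ζ)‖ * ‖fderiv ℝ (logExt f) ζ‖ / ‖Complex.exp ζ‖ := by
  refine ContinuousLinearMap.opNorm_le_bound _ (by positivity) fun v => ?_
  rw [fderiv_diskExt_exp_apply hf hper hζ, norm_mul]
  calc _ ≤ ‖Complex.exp (logExt f ζ)‖ * (‖fderiv ℝ (logExt f) ζ‖ * ‖v / Complex.exp ζ‖) := by
        gcongr
        exact ContinuousLinearMap.le_opNorm _ _
    _ = _ := by rw [norm_div]; ring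

lemma det_fderiv_logExt (hf : Continuous f) {x y : ℝ} (hy : y ≠ 0) :
    (fderiv ℝ (logExt f) ⟨-y, x⟩).det =
      ((f x - f (x - y)) * (f (x + y) - segMean f x y) +
        (f (x + y) - f x) * (segMean f x (-y) - f (x - y))) / y ^ 2 := by
  obtain ⟨h1, hI⟩ := fderiv_logExt hf (x := x) hy
  rw [Complex.clm_det_eq, h1, hI]
  field_simp
  ring

lemma det_fderiv_logExt_pos (hf : Continuous f) (hm : StrictMono f) {ζ : ℂ} (hζ : ζ.re < 0) :
    0 < (fderiv ℝ (logExt f) ζ).det := by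
  obtain ⟨y, hy⟩ : ∃ y, y = -ζ.re := ⟨_, rfl⟩
  have hy0 : 0 < y := by linarith
  have hζe : ζ = ⟨-y, ζ.im⟩ := Complex.ext (by simp [hy]) rfl
  set x := ζ.im
  rw [hζe, det_fderiv_logExt hf hy0.ne']
  have h1 : 0 < f x - f (x - y) := sub_pos.2 (hm (by linarith))
  have h2 : 0 < f (x + y) - f x := sub_pos.2 (hm (by linarith))
  have h3 : 0 < f (x + y) - segMean f x y := by
    have := segMean_lt_segMean hf hm (x := x) (y := y) (x' := x + y) (y' := 0) (by linarith)
      (by linarith) (Or.inl (by linarith))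
    rw [segMean_zero] at this
    linarith
  have h4 : 0 < segMean f x (-y) - f (x - y) := by
    have := segMean_lt_segMean hf hm (x := x - y) (y := 0) (x' := x) (y' := -y) (by linarith)
      (by linarith) (Or.inl (by linarith))
    rw [segMean_zero] at this
    linarith
  positivity

lemma dilC_diskExt_exp_le (hf : Continuous f) (hm : StrictMono f)
    (hper : ∀ x, f (x + 2 * π) = f x + 2 * π) {ζ : ℂ} (hζ : ζ.re < 0) :
    dilC (diskExt f) (Complex.exp ζ) ≤
      ‖fderiv ℝ (logExt f) ζ‖ ^ 2 / (fderiv ℝ (logExt f) ζ).det := by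
  have hd := det_fderiv_logExt_pos hf hm hζ
  have h1 := det_fderiv_diskExt_exp hf hper hζ.ne
  have h2 := norm_fderiv_diskExt_exp_le hf hper hζ.ne
  have h0 : 0 < ‖Complex.exp ζ‖ := norm_pos_iff.2 (Complex.exp_ne_zero _)
  have h0' : 0 < ‖Complex.exp (logExt f ζ)‖ := norm_pos_iff.2 (Complex.exp_ne_zero _)
  have h3 : (fderiv ℝ (diskExt f) (Complex.exp ζ)).det =
      ‖Complex.exp (logExt f ζ)‖ ^ 2 * (fderiv ℝ (logExt f) ζ).det / ‖Complex.exp ζ‖ ^ 2 := by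
    rw [← h1]; field_simp
  unfold dilC
  rw [h3]
  calc _ ≤ (‖Complex.exp (logExt f ζ)‖ * ‖fderiv ℝ (logExt f) ζ‖ / ‖Complex.exp ζ‖) ^ 2 / _ := by
        gcongr
    _ = _ := by field_simp

lemma exists_tendsto_diskExt (hf : Continuous f) (hper : ∀ x, f (x + 2 * π) = f x + 2 * π) :
    ∃ a : ℂ, a ≠ 0 ∧ HasFDerivAt (diskExt f) (ContinuousLinearMap.mul ℝ ℂ a) 0 ∧
      Tendsto (fderiv ℝ (diskExt f)) (𝓝[≠] 0) (𝓝 (ContinuousLinearMap.mul ℝ ℂ a)) := by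
  obtain ⟨c, C, hC⟩ := exists_logExt_asymptotic hf hper
  obtain ⟨C', hC'⟩ := exists_norm_fderiv_logExt_sub_le hf hper
  have hre : ∀ᶠ w : ℂ in 𝓝[≠] 0, w ≠ 0 ∧ (Complex.log w).re < 0 := by
    filter_upwards [self_mem_nhdsWithin,
      mem_nhdsWithin_of_mem_nhds (Metric.ball_mem_nhds (0 : ℂ) one_pos)] with w hw hw1
    refine ⟨hw, ?_⟩
    rw [Complex.log_re]
    exact Real.log_neg (norm_pos_iff.2 hw) (by simpa using hw1)
  have hq : Tendsto (fun w : ℂ => diskExt f w / w) (𝓝[≠] 0) (𝓝 (Complex.exp (c * Complex.I))) := by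
    have h1 : Tendsto (fun w : ℂ => logExt f (Complex.log w) - Complex.log w) (𝓝[≠] 0)
        (𝓝 (c * Complex.I)) := by
      rw [tendsto_iff_norm_sub_tendsto_zero]
      refine squeeze_zero' (Eventually.of_forall fun _ => norm_nonneg _) ?_
        (tendsto_div_neg_log_re C)
      filter_upwards [hre] with w hw using hC _ hw.2
    refine ((Complex.continuous_exp.tendsto _).comp h1).congr' ?_
    filter_upwards [hre] with w hw
    simp only [Function.comp]
    rw [Complex.exp_sub, Complex.exp_log hw.1, diskExt_of_ne_zero hw.1]
  refine ⟨Complex.exp (c * Complex.I), Complex.exp_ne_zero _, ?_, ?_⟩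
  · have h : HasDerivAt (diskExt f) (Complex.exp (c * Complex.I)) 0 := by
      rw [hasDerivAt_iff_tendsto_slope]
      refine hq.congr fun w => ?_
      simp [slope, div_eq_inv_mul]
    refine (h.hasFDerivAt.restrictScalars ℝ).congr_fderiv ?_
    ext v
    simp [mul_comm]
  · rw [tendsto_iff_norm_sub_tendsto_zero]
    have h1 : Tendsto (fun w : ℂ => ‖diskExt f w / w‖ * (C' / -(Complex.log w).re) +
        ‖diskExt f w / w - Complex.exp (c * Complex.I)‖) (𝓝[≠] 0) (𝓝 0) := by
      have h2 := (hq.norm.mul (tendsto_div_neg_log_re C')).add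
        (tendsto_iff_norm_sub_tendsto_zero.1 hq)
      simpa using h2
    refine squeeze_zero' (Eventually.of_forall fun _ => norm_nonneg _) ?_ h1
    filter_upwards [hre] with w ⟨hw0, hw⟩
    have hC1 := hC' _ hw
    have hC0 : 0 ≤ C' / -(Complex.log w).re := (norm_nonneg _).trans hC1
    refine ContinuousLinearMap.opNorm_le_bound _ (by positivity) fun v => ?_
    have e := fderiv_diskExt_exp_apply hf hper hw.ne v
    rw [Complex.exp_log hw0, ← diskExt_of_ne_zero hw0] at e
    set T := fderiv ℝ (logExt f) (Complex.log w) - ContinuousLinearMap.id ℝ ℂ with hT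
    have e2 : fderiv ℝ (logExt f) (Complex.log w) (v / w) = T (v / w) + v / w := by
      simp [hT]
    have e3 : (fderiv ℝ (diskExt f) w - ContinuousLinearMap.mul ℝ ℂ
        (Complex.exp (c * Complex.I))) v = diskExt f w * T (v / w) +
        (diskExt f w / w - Complex.exp (c * Complex.I)) * v := by
      rw [sub_apply, e, e2, ContinuousLinearMap.mul_apply']
      field_simp
      ring
    rw [e3, add_mul]
    refine (norm_add_le _ _).trans (add_le_add ?_ (norm_mul_le _ _))
    rw [norm_mul]
    calc _ ≤ ‖diskExt f w‖ * (C' / -(Complex.log w).re * ‖v / w‖) := by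
          gcongr
          exact (T.le_opNorm _).trans (by gcongr)
      _ = _ := by rw [norm_div, norm_div]; ring

lemma log_re_neg {w : ℂ} (hw : w ∈ Metric.ball (0 : ℂ) 1) (h0 : w ≠ 0) :
    (Complex.log w).re < 0 := by
  rw [Complex.log_re]
  exact Real.log_neg (norm_pos_iff.2 h0) (by simpa using hw)

lemma contDiffOn_diskExt (hf : Continuous f) (hper : ∀ x, f (x + 2 * π) = f x + 2 * π) :
    ContDiffOn ℝ 1 (diskExt f) (Metric.ball 0 1) := by
  obtain ⟨a, -, ha, hlim⟩ := exists_tendsto_diskExt hf hper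
  have hne : ∀ w ∈ Metric.ball (0 : ℂ) 1, w ≠ 0 → ContDiffAt ℝ 1 (diskExt f) w := by
    intro w hw h0
    have := contDiffAt_diskExt_exp hf hper (log_re_neg hw h0).ne
    rwa [Complex.exp_log h0] at this
  rw [← zero_add (1 : WithTop ℕ∞), contDiffOn_succ_iff_fderiv_of_isOpen Metric.isOpen_ball]
  refine ⟨fun w hw => ?_, by simp, contDiffOn_zero.2 fun w hw => ?_⟩
  · rcases eq_or_ne w 0 with rfl | h0
    · exact ha.differentiableAt.differentiableWithinAt
    · exact ((hne w hw h0).differentiableAt one_ne_zero).differentiableWithinAt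
  · rcases eq_or_ne w 0 with rfl | h0
    · refine ContinuousAt.continuousWithinAt (continuousAt_iff_punctured_nhds.2 ?_)
      rwa [ha.fderiv]
    · exact ((hne w hw h0).continuousAt_fderiv one_ne_zero).continuousWithinAt

lemma continuous_diskExt (hf : Continuous f) (hper : ∀ x, f (x + 2 * π) = f x + 2 * π) :
    Continuous (diskExt f) := by
  obtain ⟨a, -, ha, -⟩ := exists_tendsto_diskExt hf hper
  refine continuous_iff_continuousAt.2 fun w => ?_
  rcases eq_or_ne w 0 with rfl | h0
  · exact ha.continuousAt
  · simpa only [Complex.exp_log h0] using continuousAt_diskExt_exp hf hper (Complex.log w)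

lemma det_fderiv_diskExt_pos (hf : Continuous f) (hm : StrictMono f)
    (hper : ∀ x, f (x + 2 * π) = f x + 2 * π) {w : ℂ} (hw : w ∈ Metric.ball (0 : ℂ) 1) :
    0 < (fderiv ℝ (diskExt f) w).det := by
  rcases eq_or_ne w 0 with rfl | h0
  · obtain ⟨a, ha0, ha, -⟩ := exists_tendsto_diskExt hf hper
    rw [ha.fderiv, Complex.det_mulLeft]
    positivity
  · have hre := log_re_neg hw h0
    have h1 := det_fderiv_diskExt_exp hf hper hre.ne
    rw [Complex.exp_log h0] at h1
    have h2 : 0 < ‖Complex.exp (logExt f (Complex.log w))‖ ^ 2 *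
        (fderiv ℝ (logExt f) (Complex.log w)).det :=
      mul_pos (pow_pos (norm_pos_iff.2 (Complex.exp_ne_zero _)) 2) (det_fderiv_logExt_pos hf hm hre)
    rw [← h1] at h2
    exact pos_of_mul_pos_left h2 (by positivity)

lemma norm_diskExt_lt_one (hf : Continuous f) (hm : StrictMono f) {w : ℂ} (hw : ‖w‖ < 1) :
    ‖diskExt f w‖ < 1 := by
  rcases eq_or_ne w 0 with rfl | h0
  · simp
  · rw [diskExt_of_ne_zero h0, Complex.norm_exp, Real.exp_lt_one_iff]
    exact re_logExt_neg hf hm (log_re_neg (by simpa using hw) h0)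

lemma diskExt_exp_mul_I (hf : Continuous f) (hper : ∀ x, f (x + 2 * π) = f x + 2 * π) (θ : ℝ) :
    diskExt f (Complex.exp (θ * Complex.I)) = Complex.exp (f θ * Complex.I) := by
  rw [diskExt_exp hf hper, logExt_of_re_eq_zero (by simp)]
  simp

lemma norm_diskExt_eq_one (hf : Continuous f) (hper : ∀ x, f (x + 2 * π) = f x + 2 * π)
    {w : ℂ} (hw : ‖w‖ = 1) : ‖diskExt f w‖ = 1 := by
  have h : w = Complex.exp (w.arg * Complex.I) := by
    have := Complex.norm_mul_exp_arg_mul_I w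
    rw [hw] at this
    simpa using this.symm
  rw [h, diskExt_exp_mul_I hf hper, Complex.norm_exp_ofReal_mul_I]

lemma injOn_diskExt (hf : Continuous f) (hm : StrictMono f)
    (hper : ∀ x, f (x + 2 * π) = f x + 2 * π) :
    InjOn (diskExt f) (Metric.closedBall 0 1) := by
  have hne : ∀ w : ℂ, w ≠ 0 → diskExt f w ≠ 0 := fun w hw => by
    rw [diskExt_of_ne_zero hw]
    exact Complex.exp_ne_zero _
  intro w hw z hz h
  rcases eq_or_ne w 0 with rfl | hw0
  · by_contra hz0
    exact hne z (Ne.symm hz0) (by rw [← h, diskExt_zero])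
  rcases eq_or_ne z 0 with rfl | hz0
  · exact absurd (by rw [h, diskExt_zero]) (hne w hw0)
  rw [diskExt_of_ne_zero hw0, diskExt_of_ne_zero hz0] at h
  obtain ⟨n, hn⟩ := Complex.exp_eq_exp_iff_exists_int.1 h
  rw [← logExt_add_period hper hf] at hn
  have hre : ∀ u : ℂ, u ∈ Metric.closedBall (0 : ℂ) 1 → (Complex.log u).re ≤ 0 := fun u hu => by
    rw [Complex.log_re]
    exact Real.log_nonpos (norm_nonneg _) (by simpa using hu)
  have h2 := logExt_injOn hf hm (hre w hw) (by simpa using hre z hz) hn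
  rw [← Complex.exp_log hw0, ← Complex.exp_log hz0]
  exact Complex.exp_eq_exp_iff_exists_int.2 ⟨n, h2⟩

lemma ball_subset_image_diskExt (hf : Continuous f) (hm : StrictMono f)
    (hper : ∀ x, f (x + 2 * π) = f x + 2 * π) :
    Metric.ball (0 : ℂ) 1 ⊆ diskExt f '' Metric.ball 0 1 := by
  refine (convex_ball (0 : ℂ) 1).isPreconnected.subset_of_closure_inter_subset ?_ ?_ ?_
  · rw [isOpen_iff_mem_nhds]
    rintro _ ⟨w, hw, rfl⟩
    have hc := (contDiffOn_diskExt hf hper).contDiffAt (Metric.isOpen_ball.mem_nhds hw)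
    have hs := hc.hasStrictFDerivAt one_ne_zero
    have hd := (det_fderiv_diskExt_pos hf hm hper hw).ne'
    have hmap : Filter.map (diskExt f) (𝓝 w) = 𝓝 (diskExt f w) :=
      HasStrictFDerivAt.map_nhds_eq_of_equiv
        (f' := (fderiv ℝ (diskExt f) w).toContinuousLinearEquivOfDetNeZero hd) hs
    rw [← hmap]
    exact image_mem_map (Metric.isOpen_ball.mem_nhds hw)
  · exact ⟨0, by simp, 0, by simp, by simp⟩
  · rintro z ⟨hz, hz1⟩
    have hcl : IsClosed (diskExt f '' Metric.closedBall 0 1) :=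
      ((isCompact_closedBall (0 : ℂ) 1).image (continuous_diskExt hf hper)).isClosed
    obtain ⟨w, hw, rfl⟩ := closure_minimal (image_mono Metric.ball_subset_closedBall) hcl hz
    refine ⟨w, ?_, rfl⟩
    by_contra hw1
    have : ‖w‖ = 1 := le_antisymm (by simpa using hw) (by simpa using hw1)
    have h2 := norm_diskExt_eq_one hf hper this
    simp [h2] at hz1

lemma bijOn_diskExt (hf : Continuous f) (hm : StrictMono f) (hs : Surjective f)
    (hper : ∀ x, f (x + 2 * π) = f x + 2 * π) :
    BijOn (diskExt f) (Metric.closedBall 0 1) (Metric.closedBall 0 1) := by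
  refine ⟨fun w hw => ?_, injOn_diskExt hf hm hper, fun z hz => ?_⟩
  · rw [mem_closedBall_zero_iff] at hw ⊢
    rcases hw.lt_or_eq with h | h
    · exact (norm_diskExt_lt_one hf hm h).le
    · exact (norm_diskExt_eq_one hf hper h).le
  · rw [mem_closedBall_zero_iff] at hz
    rcases hz.lt_or_eq with h | h
    · exact image_mono Metric.ball_subset_closedBall
        (ball_subset_image_diskExt hf hm hper (by simpa using h))
    · obtain ⟨θ, hθ⟩ := hs z.arg
      refine ⟨Complex.exp (θ * Complex.I), by simp [Complex.norm_exp_ofReal_mul_I], ?_⟩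
      rw [diskExt_exp_mul_I hf hper, hθ]
      have := Complex.norm_mul_exp_arg_mul_I z
      rw [h] at this
      simpa using this

lemma exists_homeomorph_diskExt (hf : Continuous f) (hm : StrictMono f) (hs : Surjective f)
    (hper : ∀ x, f (x + 2 * π) = f x + 2 * π) :
    ∃ E : Metric.closedBall (0 : ℂ) 1 ≃ₜ Metric.closedBall (0 : ℂ) 1,
      ∀ p : Metric.closedBall (0 : ℂ) 1, (E p : ℂ) = diskExt f p := by
  have hb := bijOn_diskExt hf hm hs hper
  have hc : Continuous (hb.equiv (diskExt f)) :=
    ((continuous_diskExt hf hper).comp continuous_subtype_val).subtype_mk _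
  exact ⟨hc.homeoOfEquivCompactToT2, fun p => rfl⟩

end DiskExt

section Distortion

variable {f : ℝ → ℝ}

lemma segMean_le_of_le {p : ℝ → ℝ} (hp : Continuous p) {x y : ℝ} {a b s : ℝ}
    (hs : s ∈ Icc (0 : ℝ) 1) (h1 : ∀ t ∈ Icc 0 s, p (x + t * y) ≤ a)
    (h2 : ∀ t ∈ Icc s 1, p (x + t * y) ≤ b) :
    segMean p x y ≤ s * a + (1 - s) * b := by
  have hi : ∀ u v, IntervalIntegrable (fun t => p (x + t * y)) volume u v := fun u v =>
    (by fun_prop : Continuous fun t : ℝ => p (x + t * y)).intervalIntegrable _ _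
  unfold segMean
  rw [← intervalIntegral.integral_add_adjacent_intervals (hi 0 s) (hi s 1)]
  have e1 := intervalIntegral.integral_mono_on hs.1 (hi 0 s) (by simp) h1
  have e2 := intervalIntegral.integral_mono_on hs.2 (hi s 1) (by simp) h2
  simp only [intervalIntegral.integral_const, smul_eq_mul, sub_zero] at e1 e2
  linarith

lemma mul_sub_le_sub_segMean (hf : Continuous f) (hm : StrictMono f) {x y s : ℝ} (hy : 0 ≤ y)
    (hs : s ∈ Icc (0 : ℝ) 1) : s * (f (x + y) - f (x + s * y)) ≤ f (x + y) - segMean f x y := by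
  have := segMean_le_of_le (x := x) (y := y) (a := f (x + s * y)) (b := f (x + y)) hf hs
    (fun t ht => hm.monotone (by nlinarith [mul_nonneg (sub_nonneg.2 ht.2) hy]))
    (fun t ht => hm.monotone (by nlinarith [mul_nonneg (sub_nonneg.2 ht.2) hy]))
  linarith

lemma mul_sub_le_segMean_sub (hf : Continuous f) (hm : StrictMono f) {x y s : ℝ} (hy : 0 ≤ y)
    (hs : s ∈ Icc (0 : ℝ) 1) :
    s * (f (x - s * y) - f (x - y)) ≤ segMean f x (-y) - f (x - y) := by
  have := segMean_le_of_le (p := fun u => -f u) (x := x) (y := -y) (a := -f (x - s * y))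
    (b := -f (x - y)) hf.neg hs
    (fun t ht => neg_le_neg (hm.monotone (by nlinarith [mul_nonneg (sub_nonneg.2 ht.2) hy])))
    (fun t ht => neg_le_neg (hm.monotone (by nlinarith [mul_nonneg (sub_nonneg.2 ht.2) hy])))
  have h2 : segMean (fun u => -f u) x (-y) = -segMean f x (-y) := by simp [segMean]
  rw [h2] at this
  linarith

/-- An elementary inequality behind the linear dependence of the Beurling-Ahlfors dilatation on
the symmetric distortion. -/
lemma sq_le_of_distortion {a b A B d R : ℝ} (hb : 0 < b) (hba : b ≤ a) (hR : a ≤ R * b)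
    (hd : 0 ≤ d) (hda : d ≤ a) (hA : a - d ≤ 6 * A) (hB : d ≤ 3 * R * B) :
    a ^ 2 ≤ 6 * R * (b * A + a * B) := by
  have ha : 0 < a := hb.trans_le hba
  have h1 : a * (a - d) ≤ R * b * (a - d) := mul_le_mul_of_nonneg_right hR (by linarith)
  have h2 : R * b * (a - d) ≤ R * b * (6 * A) := mul_le_mul_of_nonneg_left hA (by linarith)
  have h3 : a * d ≤ a * (3 * R * B) := mul_le_mul_of_nonneg_left hB ha.le
  nlinarith [mul_nonneg ha.le hd]

lemma sq_add_le_of_distortion {a b A B d e R : ℝ} (ha : 0 < a) (hb : 0 < b) (h1 : a ≤ R * b)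
    (h2 : b ≤ R * a) (hd : 0 ≤ d) (hda : d ≤ a) (hA : a - d ≤ 6 * A) (hdB : d ≤ 3 * R * B)
    (he : 0 ≤ e) (heb : e ≤ b) (hB : b - e ≤ 6 * B) (heA : e ≤ 3 * R * A) :
    (a + b) ^ 2 ≤ 24 * R * (b * A + a * B) := by
  rcases le_total b a with hba | hba
  · have h3 := sq_le_of_distortion hb hba h1 hd hda hA hdB
    have h4 : (a + b) ^ 2 ≤ (2 * a) ^ 2 := by gcongr; linarith
    linarith
  · have h3 := sq_le_of_distortion ha hba h2 he heb hB heA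
    have h4 : (a + b) ^ 2 ≤ (2 * b) ^ 2 := by gcongr; linarith
    linarith

lemma segMean_mem_Icc (hf : Continuous f) (hm : StrictMono f) {x y : ℝ} (hy : 0 ≤ y) :
    segMean f x y ∈ Icc (f x) (f (x + y)) := by
  constructor
  · have h := segMean_le_of_le (p := fun u => -f u) (x := x) (y := y) (a := -f x) (b := -f x)
      (s := 0) hf.neg (by norm_num)
      (fun t ht => neg_le_neg (hm.monotone (by nlinarith [mul_nonneg ht.1 hy])))
      (fun t ht => neg_le_neg (hm.monotone (by nlinarith [mul_nonneg ht.1 hy])))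
    have hneg : segMean (fun u => -f u) x y = -segMean f x y := by simp [segMean]
    rw [hneg] at h
    linarith
  · have h := mul_sub_le_sub_segMean hf hm (x := x) (s := 0) hy (by norm_num)
    linarith

lemma segMean_neg_mem_Icc (hf : Continuous f) (hm : StrictMono f) {x y : ℝ} (hy : 0 ≤ y) :
    segMean f x (-y) ∈ Icc (f (x - y)) (f x) := by
  constructor
  · have h := mul_sub_le_segMean_sub hf hm (x := x) (s := 0) hy (by norm_num)
    linarith
  · have h := segMean_le_of_le (x := x) (y := -y) (a := f x) (b := f x) (s := 0)
      hf (by norm_num) (fun t ht => (hm.monotone (by nlinarith [mul_nonneg ht.1 hy])))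
      (fun t ht => (hm.monotone (by nlinarith [mul_nonneg ht.1 hy])))
    linarith

lemma norm_fderiv_logExt_le (hf : Continuous f) (hm : StrictMono f) {x y : ℝ} (hy : 0 < y) :
    ‖fderiv ℝ (logExt f) ⟨-y, x⟩‖ ≤ 3 * (f (x + y) - f (x - y)) / y := by
  obtain ⟨e1, eI⟩ := fderiv_logExt hf (x := x) hy.ne'
  obtain ⟨hA1, hA2⟩ := segMean_mem_Icc hf hm (x := x) hy.le
  obtain ⟨hB1, hB2⟩ := segMean_neg_mem_Icc hf hm (x := x) hy.le
  refine (Complex.clm_norm_le _).trans ?_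
  rw [e1, eI]
  refine (add_le_add (Complex.norm_le_abs_re_add_abs_im _)
    (Complex.norm_le_abs_re_add_abs_im _)).trans ?_
  have r5 : 3 * (f (x + y) - f (x - y)) / y =
      (f (x + y) - f (x - y)) / y + (f (x + y) - f (x - y)) / (2 * y) +
      ((f (x + y) - f (x - y)) / y + (f (x + y) - f (x - y)) / (2 * y)) := by
    field_simp
    ring
  rw [r5]
  simp only [abs_div, abs_of_pos hy, abs_of_pos (mul_pos two_pos hy)]
  gcongr <;> rw [abs_le] <;> constructor <;> linarith

/-- The dilatation of the Beurling-Ahlfors extension at height `y` above `x` is controlled by the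
distortion at scale `y` about `x` and at scale `y / 2` about `x ± y / 3`. -/
lemma dilatation_logExt_le (hf : Continuous f) (hm : StrictMono f) {x y R : ℝ} (hy : 0 < y)
    (h1 : f (x + y) - f x ≤ R * (f x - f (x - y)))
    (h2 : f x - f (x - y) ≤ R * (f (x + y) - f x))
    (h3 : f (x - y / 3 + y / 2) - f (x - y / 3) ≤ R * (f (x - y / 3) - f (x - y / 3 - y / 2)))
    (h4 : f (x + y / 3) - f (x + y / 3 - y / 2) ≤ R * (f (x + y / 3 + y / 2) - f (x + y / 3))) :
    ‖fderiv ℝ (logExt f) ⟨-y, x⟩‖ ^ 2 / (fderiv ℝ (logExt f) ⟨-y, x⟩).det ≤ 216 * R := by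
  have hdet := det_fderiv_logExt_pos hf hm (ζ := ⟨-y, x⟩) (by simpa using hy)
  rw [div_le_iff₀ hdet, det_fderiv_logExt hf hy.ne']
  have hA6 := mul_sub_le_sub_segMean hf hm (x := x) (y := y) (s := 1 / 6) hy.le (by norm_num)
  have hA3 := mul_sub_le_sub_segMean hf hm (x := x) (y := y) (s := 1 / 3) hy.le (by norm_num)
  have hB6 := mul_sub_le_segMean_sub hf hm (x := x) (y := y) (s := 1 / 6) hy.le (by norm_num)
  have hB3 := mul_sub_le_segMean_sub hf hm (x := x) (y := y) (s := 1 / 3) hy.le (by norm_num)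
  rw [show x - y / 3 + y / 2 = x + 1 / 6 * y by ring, show x - y / 3 = x - 1 / 3 * y by ring,
    show x - 1 / 3 * y - y / 2 = x - 5 / 6 * y by ring] at h3
  rw [show x + y / 3 - y / 2 = x - 1 / 6 * y by ring, show x + y / 3 = x + 1 / 3 * y by ring,
    show x + 1 / 3 * y + y / 2 = x + 5 / 6 * y by ring] at h4
  have m1 : f (x - y) < f (x - 5 / 6 * y) := hm (by linarith)
  have m2 : f (x - 1 / 3 * y) < f (x - 1 / 6 * y) := hm (by linarith)
  have m3 : f (x - y) < f (x - 1 / 6 * y) := hm (by linarith)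
  have m4 : f (x - 1 / 6 * y) < f x := hm (by linarith)
  have m5 : f x < f (x + 1 / 6 * y) := hm (by linarith)
  have m6 : f (x + 1 / 6 * y) < f (x + 1 / 3 * y) := hm (by linarith)
  have m7 : f (x + 1 / 6 * y) < f (x + y) := hm (by linarith)
  have m8 : f (x + 5 / 6 * y) < f (x + y) := hm (by linarith)
  have ha : 0 < f (x + y) - f x := by linarith
  have hb : 0 < f x - f (x - y) := by linarith
  have hR : 0 ≤ R := by
    by_contra! h
    linarith [mul_neg_of_neg_of_pos h hb]
  have h5 : R * (f (x - 1 / 3 * y) - f (x - 5 / 6 * y)) ≤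
      R * (3 * (segMean f x (-y) - f (x - y))) := mul_le_mul_of_nonneg_left (by linarith) hR
  have h6 : R * (f (x + 5 / 6 * y) - f (x + 1 / 3 * y)) ≤
      R * (3 * (f (x + y) - segMean f x y)) := mul_le_mul_of_nonneg_left (by linarith) hR
  have hkey := sq_add_le_of_distortion (d := f (x + 1 / 6 * y) - f x)
    (e := f x - f (x - 1 / 6 * y)) (A := f (x + y) - segMean f x y)
    (B := segMean f x (-y) - f (x - y)) ha hb h1 h2 (by linarith) (by linarith)
    (by linarith) (by linarith) (by linarith) (by linarith) (by linarith) (by linarith)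
  rw [sub_add_sub_cancel] at hkey
  calc _ ≤ (3 * (f (x + y) - f (x - y)) / y) ^ 2 := by
        gcongr
        exact norm_fderiv_logExt_le hf hm hy
    _ = 9 * (f (x + y) - f (x - y)) ^ 2 / y ^ 2 := by ring
    _ ≤ 9 * (24 * R * ((f x - f (x - y)) * (f (x + y) - segMean f x y) +
          (f (x + y) - f x) * (segMean f x (-y) - f (x - y)))) / y ^ 2 := by gcongr
    _ = _ := by ring

end Distortion

section CircleDistortion

lemma arcLen_exp {u v : ℝ} (huv : u < v) (hv : v < u + 2 * π) :
    arcLen (Circle.exp u) (Circle.exp v) = v - u := by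
  have h : (Circle.exp v : ℂ) / (Circle.exp u : ℂ) = Complex.exp ((v - u : ℝ) * Complex.I) := by
    rw [Circle.coe_exp, Circle.coe_exp, ← Complex.exp_sub]
    congr 1
    push_cast
    ring
  unfold arcLen
  rw [h, Complex.arg_exp_mul_I]
  rcases le_or_gt (v - u) π with hle | hgt
  · rw [(toIocMod_eq_self two_pi_pos).2 ⟨by linarith [pi_pos], by linarith⟩, if_pos (by linarith)]
  · have h2 : toIocMod two_pi_pos (-π) (v - u) = v - u - 2 * π := by
      rw [← toIocMod_sub two_pi_pos (-π) (v - u)]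
      exact (toIocMod_eq_self two_pi_pos).2 ⟨by linarith, by linarith⟩
    rw [h2, if_neg (by linarith)]
    ring

lemma sub_le_mul_of_rhoCirc_le {h : Circle → Circle} {f : ℝ → ℝ} (hm : StrictMono f)
    (hper : ∀ x, f (x + 2 * π) = f x + 2 * π)
    (hlift : ∀ x, h (Circle.exp x) = Circle.exp (f x)) {x t L : ℝ} (ht : 0 < t)
    (ht2 : t < 2 * π) (hL : rhoCirc h x t ≤ L) :
    f (x + t) - f x ≤ L * (f x - f (x - t)) ∧ f x - f (x - t) ≤ L * (f (x + t) - f x) := by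
  have h1 : f x < f (x + t) := hm (by linarith)
  have h2 : f (x - t) < f x := hm (by linarith)
  have h3 : f (x + t) < f x + 2 * π := by rw [← hper]; exact hm (by linarith)
  have h4 : f x < f (x - t) + 2 * π := by rw [← hper]; exact hm (by linarith)
  unfold rhoCirc at hL
  simp only [hlift, arcLen_exp h1 h3, arcLen_exp h2 h4] at hL
  rw [max_le_iff, div_le_iff₀ (by linarith), div_le_iff₀ (by linarith)] at hL
  exact hL

lemma exists_distortion_bound {h : Circle → Circle} {f g : ℝ → ℝ} (hm : StrictMono f)
    (hper : ∀ x, f (x + 2 * π) = f x + 2 * π)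
    (hlift : ∀ x, h (Circle.exp x) = Circle.exp (f x)) {M t₀ : ℝ} (ht₀ : t₀ ≤ 2 * π)
    (hbound : ∀ θ ∈ Icc (0 : ℝ) (2 * π), ∀ t : ℝ, 0 < t → t < t₀ →
      rhoCirc h θ t ≤ M * Real.log ((1 + g θ) / t))
    {x t : ℝ} (hx : x ∈ Icc (-(2 * π)) (2 * π)) (ht : 0 < t) (htt : t < t₀) :
    ∃ x' ∈ Icc (0 : ℝ) (2 * π), (x' = x ∨ x' = x + 2 * π) ∧
      f (x + t) - f x ≤ M * Real.log ((1 + g x') / t) * (f x - f (x - t)) ∧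
      f x - f (x - t) ≤ M * Real.log ((1 + g x') / t) * (f (x + t) - f x) := by
  rcases le_total 0 x with h0 | h0
  · exact ⟨x, ⟨h0, hx.2⟩, Or.inl rfl, sub_le_mul_of_rhoCirc_le hm hper hlift ht (by linarith)
      (hbound x ⟨h0, hx.2⟩ t ht htt)⟩
  · have hx' : x + 2 * π ∈ Icc (0 : ℝ) (2 * π) := ⟨by linarith [hx.1], by linarith⟩
    refine ⟨x + 2 * π, hx', Or.inr rfl, ?_⟩
    have := sub_le_mul_of_rhoCirc_le hm hper hlift ht (by linarith) (hbound _ hx' t ht htt)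
    rw [show x + 2 * π + t = x + t + 2 * π by ring, show x + 2 * π - t = x - t + 2 * π by ring,
      hper, hper, hper] at this
    simpa using this

end CircleDistortion

section ExponentialBound

variable {h : Circle → Circle} {f g : ℝ → ℝ} {M t₀ : ℝ}

lemma exp_mul_log_le {M g t y K : ℝ} (hM : 0 < M) (hg : 0 ≤ g) (hy : 0 < y) (hty : y / 2 ≤ t)
    (hK : K ≤ 216 * (M * Real.log ((1 + g) / t))) :
    Real.exp (1 / (432 * M) * K) ≤ (1 + g) * √(2 / y) := by
  have ht : 0 < t := by linarith
  have hq : 0 < (1 + g) / t := by positivity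
  calc Real.exp (1 / (432 * M) * K)
      ≤ Real.exp (1 / (432 * M) * (216 * (M * Real.log ((1 + g) / t)))) := by gcongr
    _ = Real.exp (Real.log ((1 + g) / t) / 2) := by
        congr 1
        field_simp
        ring
    _ = √((1 + g) / t) := by rw [← Real.log_sqrt hq.le, Real.exp_log (Real.sqrt_pos.2 hq)]
    _ ≤ √((1 + g) ^ 2 * (2 / y)) := by
        apply Real.sqrt_le_sqrt
        rw [div_eq_mul_inv]
        have h1 : t⁻¹ ≤ 2 / y := by
          rw [← inv_div]
          exact inv_anti₀ (by linarith) hty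
        gcongr
        nlinarith
    _ = (1 + g) * √(2 / y) := by
        rw [Real.sqrt_mul (by positivity), Real.sqrt_sq (by positivity)]

lemma exists_exp_dilC_le (hf : Continuous f) (hm : StrictMono f)
    (hper : ∀ x, f (x + 2 * π) = f x + 2 * π)
    (hlift : ∀ x, h (Circle.exp x) = Circle.exp (f x)) (hM : 0 < M) (ht₀ : t₀ ≤ π / 2)
    (hg0 : ∀ θ ∈ Icc (0 : ℝ) (2 * π), 0 ≤ g θ)
    (hbound : ∀ θ ∈ Icc (0 : ℝ) (2 * π), ∀ t : ℝ, 0 < t → t < t₀ →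
      rhoCirc h θ t ≤ M * Real.log ((1 + g θ) / t))
    {x y : ℝ} (hx : x ∈ Icc (-π) π) (hy : 0 < y) (hyt : y < t₀) :
    ∃ x' ∈ Icc (0 : ℝ) (2 * π), ∃ u, (u = x ∨ u = x - y / 3 ∨ u = x + y / 3) ∧
      (x' = u ∨ x' = u + 2 * π) ∧
      Real.exp (1 / (432 * M) * dilC (diskExt f) (Complex.exp ⟨-y, x⟩)) ≤
        (1 + g x') * √(2 / y) := by
  have hpi := pi_pos
  have ht₀' : t₀ ≤ 2 * π := by linarith
  obtain ⟨x₁, hx₁, hu₁, a₁, b₁⟩ := exists_distortion_bound hm hper hlift ht₀' hbound (x := x)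
    ⟨by linarith [hx.1], by linarith [hx.2]⟩ hy hyt
  obtain ⟨x₂, hx₂, hu₂, a₂, b₂⟩ := exists_distortion_bound hm hper hlift ht₀' hbound
    (x := x - y / 3) (t := y / 2) ⟨by linarith [hx.1], by linarith [hx.2]⟩ (by linarith)
    (by linarith)
  obtain ⟨x₃, hx₃, hu₃, a₃, b₃⟩ := exists_distortion_bound hm hper hlift ht₀' hbound
    (x := x + y / 3) (t := y / 2) ⟨by linarith [hx.1], by linarith [hx.2]⟩ (by linarith)
    (by linarith)
  set L₁ := M * Real.log ((1 + g x₁) / y) with hL₁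
  set L₂ := M * Real.log ((1 + g x₂) / (y / 2)) with hL₂
  set L₃ := M * Real.log ((1 + g x₃) / (y / 2)) with hL₃
  have key : ∀ R, L₁ ≤ R → L₂ ≤ R → L₃ ≤ R →
      dilC (diskExt f) (Complex.exp ⟨-y, x⟩) ≤ 216 * R := by
    intro R r₁ r₂ r₃
    refine (dilC_diskExt_exp_le hf hm hper (by simpa using hy)).trans
      (dilatation_logExt_le hf hm hy ?_ ?_ ?_ ?_)
    · exact a₁.trans (mul_le_mul_of_nonneg_right r₁ (sub_nonneg.2 (hm.monotone (by linarith))))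
    · exact b₁.trans (mul_le_mul_of_nonneg_right r₁ (sub_nonneg.2 (hm.monotone (by linarith))))
    · exact a₂.trans (mul_le_mul_of_nonneg_right r₂ (sub_nonneg.2 (hm.monotone (by linarith))))
    · exact b₃.trans (mul_le_mul_of_nonneg_right r₃ (sub_nonneg.2 (hm.monotone (by linarith))))
  have c₁ : L₂ ≤ L₁ → L₃ ≤ L₁ → _ := fun r s =>
    exp_mul_log_le hM (hg0 _ hx₁) hy (by linarith) (key L₁ le_rfl r s)
  have c₂ : L₁ ≤ L₂ → L₃ ≤ L₂ → _ := fun r s =>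
    exp_mul_log_le hM (hg0 _ hx₂) hy le_rfl (key L₂ r le_rfl s)
  have c₃ : L₁ ≤ L₃ → L₂ ≤ L₃ → _ := fun r s =>
    exp_mul_log_le hM (hg0 _ hx₃) hy le_rfl (key L₃ r s le_rfl)
  rcases le_total L₁ L₂ with r | r <;> rcases le_total L₂ L₃ with s | s <;>
    rcases le_total L₁ L₃ with q | q
  · exact ⟨x₃, hx₃, _, Or.inr (Or.inr rfl), hu₃, c₃ q s⟩
  · exact ⟨x₃, hx₃, _, Or.inr (Or.inr rfl), hu₃, c₃ (r.trans s) s⟩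
  · exact ⟨x₂, hx₂, _, Or.inr (Or.inl rfl), hu₂, c₂ r s⟩
  · exact ⟨x₂, hx₂, _, Or.inr (Or.inl rfl), hu₂, c₂ r s⟩
  · exact ⟨x₃, hx₃, _, Or.inr (Or.inr rfl), hu₃, c₃ q s⟩
  · exact ⟨x₁, hx₁, _, Or.inl rfl, hu₁, c₁ r q⟩
  · exact ⟨x₁, hx₁, _, Or.inl rfl, hu₁, c₁ r (s.trans r)⟩
  · exact ⟨x₁, hx₁, _, Or.inl rfl, hu₁, c₁ r q⟩

end ExponentialBound

section Integrability

lemma exists_measurable_majorant {g : ℝ → ℝ} {s : Set ℝ} (hs : MeasurableSet s)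
    (hsf : volume s ≠ ∞) (hg : IntegrableOn g s) :
    ∃ γ : ℝ → ℝ≥0∞, Measurable γ ∧ (∀ θ ∈ s, ENNReal.ofReal (1 + g θ) ≤ γ θ) ∧
      ∫⁻ θ, γ θ ≠ ∞ := by
  have : IsFiniteMeasure (volume.restrict s) := isFiniteMeasure_restrict.2 hsf
  have hint : Integrable (fun θ => 1 + g θ) (volume.restrict s) := (integrable_const _).add hg
  obtain ⟨γ, h1, h2, h3⟩ := exists_lt_lowerSemicontinuous_lintegral_ge_of_aemeasurable
    (volume.restrict s) (fun θ => Real.toNNReal (1 + g θ))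
    hint.aestronglyMeasurable.aemeasurable.real_toNNReal (ε := 1) one_ne_zero
  refine ⟨s.indicator γ, h2.measurable.indicator hs, fun θ hθ => ?_, ?_⟩
  · rw [indicator_of_mem hθ]
    exact (h1 θ).le
  · rw [lintegral_indicator hs]
    refine (h3.trans_lt (ENNReal.add_lt_top.2 ⟨?_, ENNReal.one_lt_top⟩)).ne
    exact hint.lintegral_lt_top

lemma lintegral_sqrt_lt_top : ∫⁻ r in Ioo (0 : ℝ) 1, ENNReal.ofReal √(2 / (1 - r)) < ∞ := by
  have h1 : IntervalIntegrable (fun r : ℝ => √2 * (1 - r) ^ (-(1 / 2) : ℝ)) volume 0 1 := by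
    have h := (intervalIntegral.intervalIntegrable_rpow' (a := 0) (b := 1)
      (r := -(1 / 2)) (by norm_num)).comp_sub_left 1
    simp only [sub_zero, sub_self] at h
    exact h.symm.const_mul _
  rw [intervalIntegrable_iff_integrableOn_Ioo_of_le zero_le_one] at h1
  have h2 : IntegrableOn (fun r : ℝ => √(2 / (1 - r))) (Ioo 0 1) := by
    refine h1.congr_fun (fun r hr => ?_) measurableSet_Ioo
    have hr1 : 0 ≤ 1 - r := by linarith [hr.2]
    simp only
    rw [Real.sqrt_div zero_le_two, Real.rpow_neg hr1, ← Real.sqrt_eq_rpow, div_eq_mul_inv]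
  exact h2.lintegral_lt_top

/-- Integrability on an annulus in terms of a bound in logarithmic coordinates. -/
lemma setLIntegral_annulus_lt_top {F : ℂ → ℝ≥0∞} {Γ : ℝ → ℝ≥0∞} {r₀ : ℝ} (hr₀ : 0 < r₀)
    (hΓ : Measurable Γ) (hΓi : ∫⁻ θ, Γ θ ≠ ∞)
    (hF : ∀ x ∈ Icc (-π) π, ∀ y, 0 < y → y < -Real.log r₀ →
      F (Complex.exp ⟨-y, x⟩) ≤
        (Γ x + Γ (x - y / 3) + Γ (x + y / 3)) * ENNReal.ofReal √(2 / y)) :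
    ∫⁻ z in Metric.ball (0 : ℂ) 1 \ Metric.closedBall 0 r₀, F z < ∞ := by
  rw [← lintegral_indicator (measurableSet_ball.diff measurableSet_closedBall),
    ← Complex.lintegral_comp_polarCoord_symm]
  set w : ℝ → ℝ≥0∞ := (Ioo (0 : ℝ) 1).indicator fun r => ENNReal.ofReal √(2 / (1 - r)) with hw
  set Φ : ℝ × ℝ → ℝ≥0∞ := fun p =>
    w p.1 * (Γ p.2 + Γ (p.2 + Real.log p.1 / 3) + Γ (p.2 + -(Real.log p.1 / 3))) with hΦ
  have hle : ∀ p ∈ polarCoord.target, ENNReal.ofReal p.1 •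
      (Metric.ball (0 : ℂ) 1 \ Metric.closedBall 0 r₀).indicator F (Complex.polarCoord.symm p)
        ≤ Φ p := by
    rintro ⟨r, θ⟩ ⟨hr, hθ⟩
    have hr : 0 < r := hr
    have hθ : θ ∈ Ioo (-π) π := hθ
    by_cases hz : Complex.polarCoord.symm (r, θ) ∈ Metric.ball (0 : ℂ) 1 \ Metric.closedBall 0 r₀
    · have hn : ‖Complex.polarCoord.symm (r, θ)‖ = r := by
        rw [Complex.norm_polarCoord_symm, abs_of_pos hr]
      have h1 : r < 1 := by simpa [hn, abs_of_pos hr] using hz.1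
      have h2 : r₀ < r := by simpa [hn, abs_of_pos hr] using hz.2
      have hy : 0 < -Real.log r := neg_pos.2 (Real.log_neg hr h1)
      have he : Complex.polarCoord.symm (r, θ) = Complex.exp ⟨-(-Real.log r), θ⟩ := by
        rw [Complex.polarCoord_symm_apply]
        have : (⟨-(-Real.log r), θ⟩ : ℂ) = (Real.log r : ℂ) + θ * Complex.I := by
          apply Complex.ext <;> simp
        rw [this, Complex.exp_add, ← Complex.ofReal_exp, Real.exp_log hr, Complex.exp_mul_I]
        push_cast
        rfl
      have h3 := hF θ ⟨hθ.1.le, hθ.2.le⟩ (-Real.log r) hy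
        (neg_lt_neg (Real.log_lt_log hr₀ h2))
      rw [indicator_of_mem hz, he, smul_eq_mul, hΦ, hw]
      simp only
      rw [indicator_of_mem (show r ∈ Ioo (0 : ℝ) 1 from ⟨hr, h1⟩)]
      have h4 : √(2 / -Real.log r) ≤ √(2 / (1 - r)) := by
        apply Real.sqrt_le_sqrt
        have := Real.log_le_sub_one_of_pos hr
        have h5 : 0 < 1 - r := by linarith
        gcongr
        linarith
      calc _ ≤ 1 * F (Complex.exp ⟨-(-Real.log r), θ⟩) := by
            gcongr
            exact ENNReal.ofReal_le_one.2 h1.le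
        _ ≤ (Γ θ + Γ (θ - -Real.log r / 3) + Γ (θ + -Real.log r / 3)) *
            ENNReal.ofReal √(2 / (1 - r)) := by
            rw [one_mul]
            exact h3.trans (by gcongr)
        _ = _ := by
            rw [mul_comm]
            congr 3
            · congr 2; ring
            · ring
    · rw [indicator_of_notMem hz, smul_zero]
      exact zero_le
  have htarget : polarCoord.target = Ioi (0 : ℝ) ×ˢ Ioo (-π) π := rfl
  have hshift : ∀ s : ℝ, ∫⁻ θ in Ioo (-π) π, Γ (θ + s) ≤ ∫⁻ θ, Γ θ := fun s =>
    (setLIntegral_le_lintegral _ _).trans (lintegral_add_right_eq_self Γ s).le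
  have hwfin : ∫⁻ r, w r < ∞ := by
    rw [hw, lintegral_indicator measurableSet_Ioo]
    exact lintegral_sqrt_lt_top
  have hwm : Measurable w := Measurable.indicator (by fun_prop) measurableSet_Ioo
  calc _ ≤ ∫⁻ p in polarCoord.target, Φ p :=
        setLIntegral_mono' polarCoord.open_target.measurableSet hle
    _ ≤ ∫⁻ r in Ioi (0 : ℝ), ∫⁻ θ in Ioo (-π) π, Φ (r, θ) := by
        rw [htarget, Measure.volume_eq_prod, ← Measure.prod_restrict]
        exact lintegral_prod_le _
    _ ≤ ∫⁻ r in Ioi (0 : ℝ), w r * (3 * ∫⁻ θ, Γ θ) := by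
        refine lintegral_mono fun r => ?_
        simp only [hΦ]
        rw [lintegral_const_mul _ (by fun_prop), lintegral_add_left (by fun_prop),
          lintegral_add_left (by fun_prop)]
        gcongr
        have h0 := hshift 0
        simp only [add_zero] at h0
        calc _ ≤ (∫⁻ θ, Γ θ) + (∫⁻ θ, Γ θ) + ∫⁻ θ, Γ θ :=
              add_le_add (add_le_add h0 (hshift _)) (hshift _)
          _ = _ := by ring
    _ ≤ ∫⁻ r, w r * (3 * ∫⁻ θ, Γ θ) := setLIntegral_le_lintegral _ _
    _ = (∫⁻ r, w r) * (3 * ∫⁻ θ, Γ θ) := lintegral_mul_const _ hwm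
    _ < ∞ := ENNReal.mul_lt_top hwfin (ENNReal.mul_lt_top (by simp) hΓi.lt_top)

variable {f : ℝ → ℝ}

lemma continuousOn_dilC_diskExt (hf : Continuous f) (hm : StrictMono f)
    (hper : ∀ x, f (x + 2 * π) = f x + 2 * π) :
    ContinuousOn (dilC (diskExt f)) (Metric.ball 0 1) := by
  have h := (contDiffOn_diskExt hf hper).continuousOn_fderiv_of_isOpen Metric.isOpen_ball le_rfl
  exact (h.norm.pow 2).div (ContinuousLinearMap.continuous_det.comp_continuousOn h)
    fun w hw => (det_fderiv_diskExt_pos hf hm hper hw).ne'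

lemma setLIntegral_exp_dilC_closedBall_lt_top (hf : Continuous f) (hm : StrictMono f)
    (hper : ∀ x, f (x + 2 * π) = f x + 2 * π) {r₀ : ℝ} (hr₀ : r₀ < 1) (p : ℝ) :
    ∫⁻ z in Metric.closedBall (0 : ℂ) r₀,
      ENNReal.ofReal (Real.exp (p * dilC (diskExt f) z)) < ∞ := by
  have hc : ContinuousOn (fun z => Real.exp (p * dilC (diskExt f) z))
      (Metric.closedBall (0 : ℂ) r₀) :=
    Real.continuous_exp.comp_continuousOn (continuousOn_const.mul
      ((continuousOn_dilC_diskExt hf hm hper).mono (Metric.closedBall_subset_ball hr₀)))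
  exact (hc.integrableOn_compact (isCompact_closedBall _ _)).lintegral_lt_top

lemma setLIntegral_exp_dilC_lt_top {h : Circle → Circle} {g : ℝ → ℝ} {M t₀ : ℝ}
    (hf : Continuous f) (hm : StrictMono f)
    (hper : ∀ x, f (x + 2 * π) = f x + 2 * π)
    (hlift : ∀ x, h (Circle.exp x) = Circle.exp (f x)) (hM : 0 < M)
    (ht₀ : t₀ ∈ Ioo (0 : ℝ) (π / 2)) (hg0 : ∀ θ ∈ Icc (0 : ℝ) (2 * π), 0 ≤ g θ)
    (hgint : IntegrableOn g (Icc (0 : ℝ) (2 * π)))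
    (hbound : ∀ θ ∈ Icc (0 : ℝ) (2 * π), ∀ t : ℝ, 0 < t → t < t₀ →
      rhoCirc h θ t ≤ M * Real.log ((1 + g θ) / t)) :
    ∫⁻ z in Metric.ball (0 : ℂ) 1,
      ENNReal.ofReal (Real.exp (1 / (432 * M) * dilC (diskExt f) z)) < ∞ := by
  set r₀ := Real.exp (-t₀) with hr₀
  have hr1 : r₀ < 1 := Real.exp_lt_one_iff.2 (by linarith [ht₀.1])
  obtain ⟨γ, hγm, hγ, hγi⟩ := exists_measurable_majorant measurableSet_Icc
    measure_Icc_lt_top.ne hgint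
  set Γ : ℝ → ℝ≥0∞ := fun θ => γ θ + γ (θ + 2 * π) with hΓ
  have hΓm : Measurable Γ := by fun_prop
  have hΓi : ∫⁻ θ, Γ θ ≠ ∞ := by
    rw [hΓ, lintegral_add_left hγm, lintegral_add_right_eq_self γ]
    exact ENNReal.add_ne_top.2 ⟨hγi, hγi⟩
  rw [← sdiff_union_of_subset (Metric.closedBall_subset_ball (x := (0 : ℂ)) hr1)]
  refine (lintegral_union_le _ _ _).trans_lt (ENNReal.add_lt_top.2
    ⟨setLIntegral_annulus_lt_top (Real.exp_pos _) hΓm hΓi fun x hx y hy hyt => ?_,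
      setLIntegral_exp_dilC_closedBall_lt_top hf hm hper hr1 _⟩)
  rw [Real.log_exp, neg_neg] at hyt
  obtain ⟨x', hx', u, hu, hxu, hle⟩ :=
    exists_exp_dilC_le hf hm hper hlift hM ht₀.2.le hg0 hbound hx hy hyt
  have h1 : ENNReal.ofReal (1 + g x') ≤ Γ u := by
    refine (hγ x' hx').trans ?_
    rcases hxu with rfl | rfl
    · exact le_self_add
    · exact le_add_self
  have h2 : Γ u ≤ Γ x + Γ (x - y / 3) + Γ (x + y / 3) := by
    rcases hu with rfl | rfl | rfl
    · exact le_self_add.trans le_self_add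
    · exact le_add_self.trans le_self_add
    · exact le_add_self
  refine (ENNReal.ofReal_le_ofReal hle).trans ?_
  rw [ENNReal.ofReal_mul (by linarith [hg0 x' hx'])]
  gcongr
  exact h1.trans h2

end Integrability

end Extension

/-- If `h : S¹ → S¹` is an orientation-preserving homeomorphism and there
are a non-negative `g ∈ L¹([0,2π])`, `M > 0` and `t₀ ∈ (0, π/2)` with
`ρ_h^c(θ,t) ≤ M log((1 + g(θ))/t)` for all `θ ∈ [0,2π]` and `0 < t < t₀`, then `h` extends
to an orientation-preserving homeomorphism `H` of the closed unit disk, continuously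
differentiable with positive Jacobian on the open disk, with exponentially integrable
distortion. -/
theorem david_extension_circle_log (h : Circle → Circle) (hh : IsOrientationPresHomeo h)
    (g : ℝ → ℝ) (hg0 : ∀ θ ∈ Icc (0 : ℝ) (2 * π), 0 ≤ g θ) (hgint : IntegrableOn g (Icc (0 : ℝ) (2 * π)))
    (M t₀ : ℝ) (hM : 0 < M) (ht₀ : t₀ ∈ Ioo (0 : ℝ) (π / 2))
    (hbound : ∀ θ ∈ Icc (0 : ℝ) (2 * π), ∀ t : ℝ, 0 < t → t < t₀ →
      rhoCirc h θ t ≤ M * Real.log ((1 + g θ) / t)) :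
    ∃ H : ℂ → ℂ,
      (∃ E : Metric.closedBall (0 : ℂ) 1 ≃ₜ Metric.closedBall (0 : ℂ) 1,
        ∀ p : Metric.closedBall (0 : ℂ) 1, (E p : ℂ) = H p) ∧
      (∀ z : Circle, H z = h z) ∧
      ContDiffOn ℝ 1 H (Metric.ball (0 : ℂ) 1) ∧
      (∀ z ∈ Metric.ball (0 : ℂ) 1, 0 < (fderiv ℝ H z).det) ∧
      ∃ p : ℝ, 0 < p ∧
        ∫⁻ z in Metric.ball (0 : ℂ) 1, ENNReal.ofReal (Real.exp (p * dilC H z)) < ⊤ := by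
  obtain ⟨f, hm, hf, hs, hper, hlift⟩ := hh
  refine ⟨diskExt f, exists_homeomorph_diskExt hf hm hs hper, fun z => ?_,
    contDiffOn_diskExt hf hper, fun z hz => det_fderiv_diskExt_pos hf hm hper hz,
    1 / (432 * M), by positivity,
    setLIntegral_exp_dilC_lt_top hf hm hper hlift hM ht₀ hg0 hgint hbound⟩
  rw [← Circle.exp_arg z, hlift, Circle.coe_exp, Circle.coe_exp, diskExt_exp_mul_I hf hper]
end
end

section
/- There exists a uniform constant C > 0 such that the following holds. Let h : ℝ → ℝ be an increasing homeomorphism and let A be a locally integrable function on the open upper half-plane ℍ whose BMO seminorm is at most M, i.e. for every closed ball B ⊆ ℍ, (1/|B|)∫_B |A − A_B| ≤ M where A_B = (1/|B|)∫_B A. Define Ǎ(x,y) = (1/(2y²)) ∫_{y/2}^{3y/2} ∫_{x−y}^{x+y} A, the average of A over the 2y × y rectangle Q_z centered at z = (x,y). Then: (a) if ρ_h(x,y) ≤ Ǎ(x,y) for all (x,y) ∈ ℍ, then K_h(x,y) ≤ C·Ǎ(x,y) + C·M for all (x,y) ∈ ℍ; and (b) if K_h(x,y) ≤ Ǎ(x,y)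 for all (x,y) ∈ ℍ, then ρ_h(x,y) ≤ 4·Ǎ(x,y) for all (x,y) ∈ ℍ. -/
open MeasureTheory Set Function

noncomputable section

/-- The symmetric distortion function of an increasing homeomorphism `h : ℝ → ℝ`. -/
def rhoDist (h : ℝ → ℝ) (x t : ℝ) : ℝ :=
  max ((h (x + t) - h x) / (h x - h (x - t)))
      ((h x - h (x - t)) / (h (x + t) - h x))

/-- `u_x` partial derivative of the Beurling–Ahlfors extension. -/
def BAux (h : ℝ → ℝ) (x y : ℝ) : ℝ := (h (x + y) - h (x - y)) / (2 * y)

/-- `u_y` partial derivative of the Beurling–Ahlfors extension. -/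
def BAuy (h : ℝ → ℝ) (x y : ℝ) : ℝ :=
  (h (x + y) + h (x - y) - (1 / y) * (∫ t in x..(x + y), h t)
    - (1 / y) * (∫ t in (x - y)..x, h t)) / (2 * y)

/-- `v_x` partial derivative of the Beurling–Ahlfors extension. -/
def BAvx (h : ℝ → ℝ) (x y : ℝ) : ℝ := (h (x + y) + h (x - y) - 2 * h x) / (2 * y)

/-- `v_y` partial derivative of the Beurling–Ahlfors extension. -/
def BAvy (h : ℝ → ℝ) (x y : ℝ) : ℝ :=
  (h (x + y) - h (x - y) - (1 / y) * (∫ t in x..(x + y), h t)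
    + (1 / y) * (∫ t in (x - y)..x, h t)) / (2 * y)

/-- The quantity `(u_x² + u_y² + v_x² + v_y²)/(u_x v_y − u_y v_x)`, which equals
`K + 1/K` for the quasiconformal dilatation `K` of the Beurling–Ahlfors extension. -/
def BAdil (h : ℝ → ℝ) (x y : ℝ) : ℝ :=
  ((BAux h x y) ^ 2 + (BAuy h x y) ^ 2 + (BAvx h x y) ^ 2 + (BAvy h x y) ^ 2) /
    (BAux h x y * BAvy h x y - BAuy h x y * BAvx h x y)

/-- The open upper half-plane, as a subset of `ℝ × ℝ`. -/
def upperHP : Set (ℝ × ℝ) := {p | 0 < p.2}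

/-- The density of the spherical measure `dσ = 4 dx dy/(1 + x² + y²)²`. -/
def sphDen (p : ℝ × ℝ) : ℝ := 4 / (1 + p.1 ^ 2 + p.2 ^ 2) ^ 2

/-- The closed Euclidean ball of center `c` and radius `r` in `ℝ × ℝ`. -/
def eBall (c : ℝ × ℝ) (r : ℝ) : Set (ℝ × ℝ) :=
  {p | (p.1 - c.1) ^ 2 + (p.2 - c.2) ^ 2 ≤ r ^ 2}

/-- The average of `A` over a set `s` (with respect to Lebesgue measure). -/
def setAvg (A : ℝ × ℝ → ℝ) (s : Set (ℝ × ℝ)) : ℝ :=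
  (∫ p in s, A p) / (MeasureTheory.volume s).toReal

/-- `Â(z)`: the average of `A` over the ball `B(z, Im z / 2)`. -/
def hatAvg (A : ℝ × ℝ → ℝ) (p : ℝ × ℝ) : ℝ := setAvg A (eBall p (p.2 / 2))

/-- `Ǎ(x,y)`: the average of `A` over the `2y × y` rectangle centered at `(x,y)`,
`(1/(2y²)) ∫_{y/2}^{3y/2} ∫_{x−y}^{x+y} A`. -/
def checkAvg (A : ℝ × ℝ → ℝ) (x y : ℝ) : ℝ :=
  (1 / (2 * y ^ 2)) * ∫ t in (y / 2)..(3 * y / 2), ∫ s in (x - y)..(x + y), A (s, t)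

/-- `A` is locally integrable on the open upper half-plane, in the sense that it is
integrable on every closed ball contained in it. -/
def LocIntUHP (A : ℝ × ℝ → ℝ) : Prop :=
  ∀ (c : ℝ × ℝ) (r : ℝ), 0 < r → eBall c r ⊆ upperHP →
    MeasureTheory.IntegrableOn A (eBall c r)

/-- The BMO seminorm of `A` on the open upper half-plane is at most `M`: for every closed
ball `B ⊆ ℍ`, `(1/|B|) ∫_B |A − A_B| ≤ M`. -/
def BMOSeminormLE (A : ℝ × ℝ → ℝ) (M : ℝ) : Prop :=
  ∀ (c : ℝ × ℝ) (r : ℝ), 0 < r → eBall c r ⊆ upperHP →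
    (∫ p in eBall c r, |A p - setAvg A (eBall c r)|) /
      (MeasureTheory.volume (eBall c r)).toReal ≤ M

lemma Monotone.step_le_integral {h : ℝ → ℝ} (hm : Monotone h) {u v w : ℝ}
    (huv : u ≤ v) (hvw : v ≤ w) :
    (v - u) * h u + (w - v) * h v ≤ ∫ t in u..w, h t ∧
      ∫ t in u..w, h t ≤ (v - u) * h v + (w - v) * h w := by
  have bound : ∀ {a b : ℝ}, a ≤ b →
      (b - a) * h a ≤ ∫ t in a..b, h t ∧ ∫ t in a..b, h t ≤ (b - a) * h b := by
    intro a b hab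
    have hi : IntervalIntegrable h volume a b := hm.intervalIntegrable
    constructor
    · have := intervalIntegral.integral_mono_on hab
        (intervalIntegrable_const (c := h a)) hi (fun t ht => hm ht.1)
      simpa using this
    · have := intervalIntegral.integral_mono_on hab hi
        (intervalIntegrable_const (c := h b)) (fun t ht => hm ht.2)
      simpa using this
  have hsplit := intervalIntegral.integral_add_adjacent_intervals
    (hm.intervalIntegrable (μ := volume) (a := u) (b := v))
    (hm.intervalIntegrable (μ := volume) (a := v) (b := w))
  have h1 := bound huv
  have h2 := bound hvw
  constructor <;> linarith

/-- The mean gap between `h (x + y)` and `h` on `[x, x + y]`. -/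
def rightGap (h : ℝ → ℝ) (x y : ℝ) : ℝ := h (x + y) - (1 / y) * ∫ t in x..(x + y), h t

/-- The mean gap between `h` on `[x - y, x]` and `h (x - y)`. -/
def leftGap (h : ℝ → ℝ) (x y : ℝ) : ℝ := (1 / y) * (∫ t in (x - y)..x, h t) - h (x - y)

lemma BAdil_eq (h : ℝ → ℝ) (x : ℝ) {y : ℝ} (hy : 0 < y) :
    BAdil h x y =
      ((h (x + y) - h x) ^ 2 + (h x - h (x - y)) ^ 2 + rightGap h x y ^ 2 + leftGap h x y ^ 2) /
        ((h (x + y) - h x) * leftGap h x y + (h x - h (x - y)) * rightGap h x y) := by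
  unfold BAdil BAux BAuy BAvx BAvy rightGap leftGap
  rw [← mul_div_mul_left _ _ (show (2 * y ^ 2 : ℝ) ≠ 0 by positivity)]
  congr 1 <;> (field_simp; ring)

lemma rightGap_bounds {h : ℝ → ℝ} (hm : Monotone h) (x : ℝ) {y s : ℝ} (hy : 0 < y)
    (hs0 : 0 ≤ s) (hs1 : s ≤ 1) :
    s * (h (x + y) - h (x + s * y)) ≤ rightGap h x y ∧ rightGap h x y ≤ h (x + y) - h x := by
  have hsy : s * y ≤ y := by nlinarith
  have hsy0 : 0 ≤ s * y := by positivity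
  have h1 := (hm.step_le_integral (u := x) (v := x + s * y) (w := x + y)
    (by linarith) (by linarith)).2
  have h2 := (hm.step_le_integral (u := x) (v := x) (w := x + y) le_rfl (by linarith)).1
  unfold rightGap
  constructor
  · have : (1 / y) * ∫ t in x..(x + y), h t ≤ s * h (x + s * y) + (1 - s) * h (x + y) := by
      rw [one_div_mul_eq_div, div_le_iff₀ hy]; linarith
    linarith
  · have : h x ≤ (1 / y) * ∫ t in x..(x + y), h t := by
      rw [one_div_mul_eq_div, le_div_iff₀ hy]; linarith
    linarith

lemma leftGap_bounds {h : ℝ → ℝ} (hm : Monotone h) (x : ℝ) {y s : ℝ} (hy : 0 < y)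
    (hs0 : 0 ≤ s) (hs1 : s ≤ 1) :
    s * (h (x - s * y) - h (x - y)) ≤ leftGap h x y ∧ leftGap h x y ≤ h x - h (x - y) := by
  have hsy : s * y ≤ y := by nlinarith
  have hsy0 : 0 ≤ s * y := by positivity
  have h1 := (hm.step_le_integral (u := x - y) (v := x - s * y) (w := x)
    (by linarith) (by linarith)).1
  have h2 := (hm.step_le_integral (u := x - y) (v := x) (w := x) (by linarith) le_rfl).2
  unfold leftGap
  constructor
  · have : s * h (x - s * y) + (1 - s) * h (x - y) ≤ (1 / y) * ∫ t in (x - y)..x, h t := by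
      rw [one_div_mul_eq_div, le_div_iff₀ hy]; linarith
    linarith
  · have : (1 / y) * ∫ t in (x - y)..x, h t ≤ h x := by
      rw [one_div_mul_eq_div, div_le_iff₀ hy]; linarith
    linarith

lemma dilatation_le_of_ratio_le {a b p q K R : ℝ} (hb : 0 < b) (hp : 0 < p)
    (hq : 0 < q) (hpa : p ≤ a) (hqb : q ≤ b) (hba : b ≤ a) (hK : 1 ≤ K)
    (hKeq : K + K⁻¹ = (a ^ 2 + b ^ 2 + p ^ 2 + q ^ 2) / (a * q + b * p))
    (hR : a ≤ R * b) (hRq : 8 * p < a → 3 * a ≤ 16 * (R * q)) : K ≤ 32 * R := by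
  have ha : 0 < a := hb.trans_le hba
  have hD : 0 < a * q + b * p := by positivity
  have hKle : K ≤ (a ^ 2 + b ^ 2 + p ^ 2 + q ^ 2) / (a * q + b * p) := by
    have : 0 < K⁻¹ := by positivity
    linarith
  rw [le_div_iff₀ hD] at hKle
  have hR0 : 0 < R := by
    by_contra hcon
    nlinarith
  have hN : a ^ 2 + b ^ 2 + p ^ 2 + q ^ 2 ≤ 4 * a ^ 2 := by nlinarith
  have hRD : a ^ 2 ≤ 8 * (R * (a * q + b * p)) := by
    have h1 : 0 ≤ R * (a * q) := by positivity
    have h2 : 0 ≤ R * (b * p) := by positivity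
    rcases lt_or_ge (8 * p) a with h | h
    · nlinarith [mul_le_mul_of_nonneg_left (hRq h) ha.le]
    · nlinarith [mul_le_mul hR h ha.le (by positivity)]
  refine le_of_mul_le_mul_right ?_ hD
  nlinarith

lemma ratio_le_dilatation {a b p q K : ℝ} (ha : 0 < a) (hb : 0 < b) (hp : 0 < p)
    (hq : 0 < q) (hpa : p ≤ a) (hqb : q ≤ b) (hK : 1 ≤ K)
    (hKeq : K + K⁻¹ = (a ^ 2 + b ^ 2 + p ^ 2 + q ^ 2) / (a * q + b * p)) : a / b ≤ 4 * K := by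
  have hD : 0 < a * q + b * p := by positivity
  have hinv : K⁻¹ ≤ 1 := inv_le_one_of_one_le₀ hK
  have h2 : (a ^ 2 + b ^ 2 + p ^ 2 + q ^ 2) / (a * q + b * p) ≤ 2 * K := by linarith
  rw [div_le_iff₀ hD] at h2
  have hDab : a * q + b * p ≤ 2 * (a * b) := by nlinarith
  rw [div_le_iff₀ hb]
  refine le_of_mul_le_mul_left ?_ ha
  nlinarith [mul_le_mul_of_nonneg_left hDab (show 0 ≤ K by linarith), sq_nonneg b, sq_nonneg p,
    sq_nonneg q]

lemma sub_le_mul_of_rhoDist_le {h : ℝ → ℝ} (hm : StrictMono h) {x t R : ℝ} (ht : 0 < t)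
    (hR : rhoDist h x t ≤ R) :
    h (x + t) - h x ≤ R * (h x - h (x - t)) ∧ h x - h (x - t) ≤ R * (h (x + t) - h x) := by
  have h1 := hm (show x < x + t by linarith)
  have h2 := hm (show x - t < x by linarith)
  have h3 := max_le_iff.1 hR
  rw [div_le_iff₀ (by linarith), div_le_iff₀ (by linarith)] at h3
  exact h3

lemma dilatation_le_of_rhoDist_le {h : ℝ → ℝ} (hm : StrictMono h) {x y K R : ℝ} (hy : 0 < y)
    (hK : 1 ≤ K) (hKeq : K + K⁻¹ = BAdil h x y) (hR : rhoDist h x y ≤ R)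
    (hRl : rhoDist h (x - y / 4) (3 * y / 4) ≤ R)
    (hRr : rhoDist h (x + y / 4) (3 * y / 4) ≤ R) : K ≤ 32 * R := by
  rw [BAdil_eq h x hy] at hKeq
  have hb := sub_pos.2 (hm (show x - y < x by linarith))
  have ha := sub_pos.2 (hm (show x < x + y by linarith))
  obtain ⟨hp2, hpa⟩ := rightGap_bounds hm.monotone x hy (s := 1 / 2) (by norm_num) (by norm_num)
  obtain ⟨hq2, hqb⟩ := leftGap_bounds hm.monotone x hy (s := 1 / 2) (by norm_num) (by norm_num)
  have hp4 := (rightGap_bounds hm.monotone x hy (s := 1 / 4) (by norm_num) (by norm_num)).1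
  have hq4 := (leftGap_bounds hm.monotone x hy (s := 1 / 4) (by norm_num) (by norm_num)).1
  have hp : 0 < rightGap h x y := by
    linarith [hm (show x + 1 / 2 * y < x + y by linarith)]
  have hq : 0 < leftGap h x y := by
    linarith [hm (show x - y < x - 1 / 2 * y by linarith)]
  obtain ⟨hab, hba⟩ := sub_le_mul_of_rhoDist_le hm hy hR
  have hl := (sub_le_mul_of_rhoDist_le hm (by positivity) hRl).1
  have hr := (sub_le_mul_of_rhoDist_le hm (by positivity) hRr).2
  rw [show x - y / 4 + 3 * y / 4 = x + 1 / 2 * y by ring,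
    show x - y / 4 - 3 * y / 4 = x - y by ring, show x - y / 4 = x - 1 / 4 * y by ring] at hl
  rw [show x + y / 4 + 3 * y / 4 = x + y by ring,
    show x + y / 4 - 3 * y / 4 = x - 1 / 2 * y by ring,
    show x + y / 4 = x + 1 / 4 * y by ring] at hr
  have hR0 : 0 < R := by
    by_contra hcon
    nlinarith
  rcases le_total (h x - h (x - y)) (h (x + y) - h x) with hle | hle
  · refine dilatation_le_of_ratio_le hb hp hq hpa hqb hle hK hKeq hab fun hlt => ?_
    have := hm (show x - 1 / 4 * y < x by linarith)
    nlinarith [mul_le_mul_of_nonneg_left hq4 hR0.le]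
  · refine dilatation_le_of_ratio_le ha hq hp hqb hpa hle hK (hKeq.trans ?_) hba fun hlt => ?_
    · congr 1 <;> ring
    · have := hm (show x < x + 1 / 4 * y by linarith)
      nlinarith [mul_le_mul_of_nonneg_left hp4 hR0.le]

lemma rhoDist_le_dilatation {h : ℝ → ℝ} (hm : StrictMono h) {x y K : ℝ} (hy : 0 < y)
    (hK : 1 ≤ K) (hKeq : K + K⁻¹ = BAdil h x y) : rhoDist h x y ≤ 4 * K := by
  rw [BAdil_eq h x hy] at hKeq
  have hb := sub_pos.2 (hm (show x - y < x by linarith))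
  have ha := sub_pos.2 (hm (show x < x + y by linarith))
  obtain ⟨hp2, hpa⟩ := rightGap_bounds hm.monotone x hy (s := 1 / 2) (by norm_num) (by norm_num)
  obtain ⟨hq2, hqb⟩ := leftGap_bounds hm.monotone x hy (s := 1 / 2) (by norm_num) (by norm_num)
  have hp : 0 < rightGap h x y := by
    linarith [hm (show x + 1 / 2 * y < x + y by linarith)]
  have hq : 0 < leftGap h x y := by
    linarith [hm (show x - y < x - 1 / 2 * y by linarith)]
  refine max_le (ratio_le_dilatation ha hb hp hq hpa hqb hK hKeq)
    (ratio_le_dilatation hb ha hq hp hqb hpa hK (hKeq.trans ?_))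
  congr 1 <;> ring

lemma volume_eBall_le (c : ℝ × ℝ) {r : ℝ} (hr : 0 ≤ r) :
    volume (eBall c r) ≤ ENNReal.ofReal (4 * r ^ 2) := by
  have hsub : eBall c r ⊆ Icc (c.1 - r) (c.1 + r) ×ˢ Icc (c.2 - r) (c.2 + r) := by
    intro p hp
    have hp : (p.1 - c.1) ^ 2 + (p.2 - c.2) ^ 2 ≤ r ^ 2 := hp
    have h1 := abs_le_of_sq_le_sq' (show (p.1 - c.1) ^ 2 ≤ r ^ 2 by nlinarith) hr
    have h2 := abs_le_of_sq_le_sq' (show (p.2 - c.2) ^ 2 ≤ r ^ 2 by nlinarith) hr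
    refine ⟨⟨?_, ?_⟩, ?_, ?_⟩ <;> linarith
  refine (measure_mono hsub).trans (le_of_eq ?_)
  rw [Measure.volume_eq_prod, Measure.prod_prod, Real.volume_Icc, Real.volume_Icc,
    ← ENNReal.ofReal_mul (by linarith)]
  congr 1
  ring

lemma checkAvg_eq_setIntegral {A : ℝ × ℝ → ℝ} {x y : ℝ} (hy : 0 < y)
    (hA : IntegrableOn A (Ioc (x - y) (x + y) ×ˢ Ioc (y / 2) (3 * y / 2))) :
    checkAvg A x y =
      (1 / (2 * y ^ 2)) * ∫ p in Ioc (x - y) (x + y) ×ˢ Ioc (y / 2) (3 * y / 2), A p := by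
  unfold checkAvg
  rw [intervalIntegral.integral_of_le (by linarith)]
  simp_rw [intervalIntegral.integral_of_le (show x - y ≤ x + y by linarith)]
  rw [Measure.volume_eq_prod, IntegrableOn, ← Measure.prod_restrict] at hA
  rw [Measure.volume_eq_prod, ← Measure.prod_restrict, integral_prod_symm A hA]

lemma integral_abs_sub_setAvg_le {A : ℝ × ℝ → ℝ} {M : ℝ} (hM : BMOSeminormLE A M)
    {c : ℝ × ℝ} {r : ℝ} (hr : 0 < r) (hB : eBall c r ⊆ upperHP) :
    0 ≤ M ∧ ∫ p in eBall c r, |A p - setAvg A (eBall c r)| ≤ 4 * r ^ 2 * M := by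
  have hle := hM c r hr hB
  have hI : 0 ≤ ∫ p in eBall c r, |A p - setAvg A (eBall c r)| :=
    integral_nonneg fun _ => abs_nonneg _
  have hM0 : 0 ≤ M := (div_nonneg hI ENNReal.toReal_nonneg).trans hle
  refine ⟨hM0, ?_⟩
  have hvol := volume_eBall_le c hr.le
  rcases eq_or_ne (volume (eBall c r)) 0 with h0 | h0
  · rw [Measure.restrict_eq_zero.2 h0, integral_zero_measure]
    positivity
  · have hpos := ENNReal.toReal_pos h0 (hvol.trans_lt ENNReal.ofReal_lt_top).ne
    rw [div_le_iff₀ hpos] at hle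
    have := ENNReal.toReal_le_of_le_ofReal (by positivity) hvol
    nlinarith

lemma abs_checkAvg_sub_setAvg_le {A : ℝ × ℝ → ℝ} {M : ℝ} (hA : LocIntUHP A)
    (hM : BMOSeminormLE A M) {x y r : ℝ} {c : ℝ × ℝ} (hy : 0 < y) (hr : 0 < r)
    (hB : eBall c r ⊆ upperHP)
    (hQ : Ioc (x - y) (x + y) ×ˢ Ioc (y / 2) (3 * y / 2) ⊆ eBall c r) :
    |checkAvg A x y - setAvg A (eBall c r)| ≤ 2 * (r / y) ^ 2 * M := by
  have hAB := hA c r hr hB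
  have hI := (integral_abs_sub_setAvg_le hM hr hB).2
  set m := setAvg A (eBall c r)
  have hfin : volume (eBall c r) ≠ ⊤ :=
    ((volume_eBall_le c hr.le).trans_lt ENNReal.ofReal_lt_top).ne
  have hdB : IntegrableOn (fun p => A p - m) (eBall c r) := hAB.sub (integrableOn_const hfin)
  rw [checkAvg_eq_setIntegral hy (hAB.mono_set hQ)]
  set Q := Ioc (x - y) (x + y) ×ˢ Ioc (y / 2) (3 * y / 2)
  have hQfin : volume Q ≠ ⊤ := ((measure_mono hQ).trans_lt hfin.lt_top).ne
  have hvolQ : volume.real Q = 2 * y ^ 2 := by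
    rw [Measure.real, Measure.volume_eq_prod, Measure.prod_prod, Real.volume_Ioc,
      Real.volume_Ioc, ← ENNReal.ofReal_mul (by linarith), ENNReal.toReal_ofReal]
    · ring
    · nlinarith
  have hsub : ∫ p in Q, (A p - m) = (∫ p in Q, A p) - 2 * y ^ 2 * m := by
    rw [integral_sub (hAB.mono_set hQ) (integrableOn_const hQfin), setIntegral_const, hvolQ,
      smul_eq_mul]
  have heq : (1 / (2 * y ^ 2)) * (∫ p in Q, A p) - m =
      (1 / (2 * y ^ 2)) * ∫ p in Q, (A p - m) := by
    rw [hsub]; field_simp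
  have hchain : |∫ p in Q, (A p - m)| ≤ 4 * r ^ 2 * M :=
    (abs_integral_le_integral_abs).trans
      ((setIntegral_mono_set hdB.abs (Filter.Eventually.of_forall fun _ => abs_nonneg _)
        hQ.eventuallyLE).trans hI)
  rw [heq, abs_mul, abs_of_pos (by positivity)]
  calc (1 / (2 * y ^ 2)) * |∫ p in Q, (A p - m)|
      ≤ (1 / (2 * y ^ 2)) * (4 * r ^ 2 * M) := by gcongr
    _ = 2 * (r / y) ^ 2 * M := by field_simp; norm_num

lemma checkAvg_le_of_abs_le {A : ℝ × ℝ → ℝ} {M : ℝ} (hA : LocIntUHP A)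
    (hM : BMOSeminormLE A M) {x y x' : ℝ} (hy : 0 < y) (hx' : |x' - x| ≤ y / 4) :
    0 ≤ M ∧ checkAvg A x' (3 * y / 4) ≤ checkAvg A x y + 24 * M := by
  obtain ⟨hl, hu⟩ := abs_le.1 hx'
  have hr : 0 < 39 / 20 * y := by positivity
  have hB : eBall (x, 2 * y) (39 / 20 * y) ⊆ upperHP := by
    intro p hp
    have hp : (p.1 - x) ^ 2 + (p.2 - 2 * y) ^ 2 ≤ (39 / 20 * y) ^ 2 := hp
    have := abs_le_of_sq_le_sq' (show (p.2 - 2 * y) ^ 2 ≤ (39 / 20 * y) ^ 2 by nlinarith) hr.le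
    change 0 < p.2
    linarith
  have hmem : ∀ p : ℝ × ℝ, x - y ≤ p.1 → p.1 ≤ x + y → 3 * y / 8 ≤ p.2 → p.2 ≤ 3 * y / 2 →
      p ∈ eBall (x, 2 * y) (39 / 20 * y) := by
    intro p h1 h2 h3 h4
    change (p.1 - x) ^ 2 + (p.2 - 2 * y) ^ 2 ≤ (39 / 20 * y) ^ 2
    have e1 : (p.1 - x) ^ 2 ≤ y ^ 2 := sq_le_sq' (by linarith) (by linarith)
    have e2 : (p.2 - 2 * y) ^ 2 ≤ (13 / 8 * y) ^ 2 := sq_le_sq' (by linarith) (by linarith)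
    nlinarith
  have hM0 := (integral_abs_sub_setAvg_le hM hr hB).1
  have h1 := abs_checkAvg_sub_setAvg_le (x := x) hA hM hy hr hB (by
    rintro p ⟨⟨_, _⟩, _, _⟩
    apply hmem p <;> linarith)
  have h2 := abs_checkAvg_sub_setAvg_le (x := x') hA hM
    (show 0 < 3 * y / 4 by positivity) hr hB (by
    rintro p ⟨⟨_, _⟩, _, _⟩
    apply hmem p <;> linarith)
  rw [show 39 / 20 * y / y = 39 / 20 by field_simp] at h1
  rw [show 39 / 20 * y / (3 * y / 4) = 13 / 5 by field_simp; norm_num] at h2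
  refine ⟨hM0, ?_⟩
  linarith [abs_le.1 h1, abs_le.1 h2]

/-- There is a uniform `C > 0` such that for any increasing homeomorphism
`h : ℝ → ℝ` with Beurling–Ahlfors dilatation `K`, and any `A ∈ BMO(ℍ)` with seminorm `≤ M`:
(a) if `ρ_h ≤ Ǎ` on `ℍ` then `K ≤ C Ǎ + C M` on `ℍ`; and
(b) if `K ≤ Ǎ` on `ℍ` then `ρ_h ≤ 4 Ǎ` on `ℍ`. -/
theorem bmo_majorant_check :
    ∃ C : ℝ, 0 < C ∧
      ∀ (h : ℝ → ℝ), StrictMono h → Surjective h →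
      ∀ (K : ℝ → ℝ → ℝ),
        (∀ x y : ℝ, 0 < y → 1 ≤ K x y ∧ K x y + (K x y)⁻¹ = BAdil h x y) →
      ∀ (A : ℝ × ℝ → ℝ) (M : ℝ), LocIntUHP A → BMOSeminormLE A M →
        ((∀ p ∈ upperHP, rhoDist h p.1 p.2 ≤ checkAvg A p.1 p.2) →
          ∀ p ∈ upperHP, K p.1 p.2 ≤ C * checkAvg A p.1 p.2 + C * M) ∧
        ((∀ p ∈ upperHP, K p.1 p.2 ≤ checkAvg A p.1 p.2) →
          ∀ p ∈ upperHP, rhoDist h p.1 p.2 ≤ 4 * checkAvg A p.1 p.2) := by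
  refine ⟨768, by norm_num, fun h hm _ K hK A M hA hM => ⟨fun hρ p hp => ?_, fun hKA p hp => ?_⟩⟩
  · obtain ⟨x, y⟩ := p
    have hy : 0 < y := hp
    obtain ⟨hM0, hl⟩ := checkAvg_le_of_abs_le (x := x) (x' := x - y / 4) hA hM hy (by
      rw [sub_sub_cancel_left, abs_neg, abs_of_pos (by positivity)])
    have hr := (checkAvg_le_of_abs_le (x := x) (x' := x + y / 4) hA hM hy (by
      rw [add_sub_cancel_left, abs_of_pos (by positivity)])).2
    have hy' : 0 < 3 * y / 4 := by positivity
    have h0 : rhoDist h x y ≤ checkAvg A x y := hρ (x, y) hp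
    have hKle := dilatation_le_of_rhoDist_le hm hy (hK x y hy).1 (hK x y hy).2
      (R := checkAvg A x y + 24 * M) (by linarith)
      ((hρ (x - y / 4, 3 * y / 4) hy').trans hl) ((hρ (x + y / 4, 3 * y / 4) hy').trans hr)
    have hpos : 0 ≤ checkAvg A x y := by
      refine le_trans (le_max_of_le_left (div_nonneg ?_ ?_)) h0
      · linarith [hm (show x < x + y by linarith)]
      · linarith [hm (show x - y < x by linarith)]
    change K x y ≤ 768 * checkAvg A x y + 768 * M
    linarith
  · have hKp := hK p.1 p.2 hp
    linarith [rhoDist_le_dilatation hm hp hKp.1 hKp.2, hKA p hp]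
end
end
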